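/- arXiv:2106.16070 — 4 statements merged into one kernel-verified Lean document; each statement's English description precedes it below -/
import Mathlib

section
/- Stochastic block model, larger retention probability: take p = 1/(4b) and seed count s = n/3. Then with high probability as n → ∞ (over the random graph G), E_p[f1] ≤ (11/12)·E_p[f2]; equivalently, E_p[f2] − E_p[f1] ≥ s/4 = n/12, so uniform seeding infects more nodes in expectation than central seeding. -/
open scoped Classical
open Finset

/-- Weight of an edge-configuration `f` when each potential edge `e` is present
independently with probability `q e`. -/
noncomputable def configWeight {n : ℕ} (q : Sym2 (Fin n) → ℝ) (f : Sym2 (Fin n) → Bool) : ℝ :=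
  ∏ e : Sym2 (Fin n), if f e then q e else 1 - q e

/-- The simple graph determined by an edge-configuration. -/
def graphOfConfig {n : ℕ} (f : Sym2 (Fin n) → Bool) : SimpleGraph (Fin n) :=
  SimpleGraph.fromRel (fun i j => f s(i, j))

/-- Expectation of `X` over the inhomogeneous random graph with edge probabilities `q`. -/
noncomputable def irgExp {n : ℕ} (q : Sym2 (Fin n) → ℝ) (X : SimpleGraph (Fin n) → ℝ) : ℝ :=
  ∑ f : Sym2 (Fin n) → Bool, configWeight q f * X (graphOfConfig f)

/-- Expectation of `X` over bond percolation of the fixed graph `G`, each edge of `G`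
being retained independently with probability `p`. -/
noncomputable def percExp {n : ℕ} (G : SimpleGraph (Fin n)) (p : ℝ)
    (X : SimpleGraph (Fin n) → ℝ) : ℝ :=
  irgExp (fun e => if e ∈ G.edgeSet then p else 0) X

/-- `|G(S)|`: the number of vertices in the union of the connected components of `G`
meeting the seed set `S`. -/
noncomputable def clusterSize {n : ℕ} (G : SimpleGraph (Fin n)) (S : Finset (Fin n)) : ℕ :=
  Set.ncard {v : Fin n | ∃ u ∈ S, G.Reachable u v}

/-- The central region `U`: the first `n / 2` nodes. -/
def centralSet (n : ℕ) : Finset (Fin n) := Finset.univ.filter (fun i => i.val < n / 2)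

/-- Edge probabilities of the stochastic block model: `a / n` within the central region,
`b / n` for every other pair (clamped at 1). -/
noncomputable def sbmQ (n : ℕ) (a b : ℝ) : Sym2 (Fin n) → ℝ :=
  fun e => if ∀ i ∈ e, i ∈ centralSet n then min 1 (a / n) else min 1 (b / n)

/-- Probability, over the stochastic block model random graph `G`, of the event `P`. -/
noncomputable def sbmProb (n : ℕ) (a b : ℝ) (P : SimpleGraph (Fin n) → Prop) : ℝ :=
  ∑ f : Sym2 (Fin n) → Bool,
    configWeight (sbmQ n a b) f * (if P (graphOfConfig f) then 1 else 0)

/-- `E_p[f_i ∣ G]`: conditional expectation, given the graph `G`, of the number of infected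
vertices, over the bond percolation with retention probability `p` and over a uniformly
random `s`-element seed subset of `A`. -/
noncomputable def seedPercExp {n : ℕ} (G : SimpleGraph (Fin n)) (p : ℝ)
    (A : Finset (Fin n)) (s : ℕ) : ℝ :=
  (∑ S ∈ Finset.powersetCard s A, percExp G p (fun H => (clusterSize H S : ℝ))) /
    ((Finset.powersetCard s A).card : ℝ)
/-- Expectation over configurations. -/
noncomputable def cE {n : ℕ} (q : Sym2 (Fin n) → ℝ) (F : (Sym2 (Fin n) → Bool) → ℝ) : ℝ :=
  ∑ f : Sym2 (Fin n) → Bool, configWeight q f * F f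

lemma cE_prod {n : ℕ} (q : Sym2 (Fin n) → ℝ) (g : Sym2 (Fin n) → Bool → ℝ) :
    cE q (fun f => ∏ e, g e (f e)) = ∏ e, (q e * g e true + (1 - q e) * g e false) := by
  unfold cE configWeight
  have h := Finset.prod_univ_sum (fun _ : Sym2 (Fin n) => (Finset.univ : Finset Bool))
    (fun e c => (if c then q e else 1 - q e) * g e c)
  rw [Fintype.piFinset_univ] at h
  simp only [Fintype.sum_bool] at h
  simp only [if_true, Bool.false_eq_true, if_false] at h
  rw [h]
  refine Finset.sum_congr rfl fun f _ => ?_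
  rw [Finset.prod_mul_distrib]

lemma cW_nonneg {n : ℕ} {q : Sym2 (Fin n) → ℝ} (h0 : ∀ e, 0 ≤ q e) (h1 : ∀ e, q e ≤ 1)
    (f : Sym2 (Fin n) → Bool) : 0 ≤ configWeight q f := by
  unfold configWeight
  refine Finset.prod_nonneg fun e _ => ?_
  split_ifs
  · exact h0 e
  · linarith [h1 e]

lemma cE_const {n : ℕ} (q : Sym2 (Fin n) → ℝ) (c : ℝ) : cE q (fun _ => c) = c := by
  have h := cE_prod q (fun _ _ => 1)
  simp only [Finset.prod_const_one, mul_one, add_sub_cancel] at h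
  unfold cE at *
  rw [← Finset.sum_mul]
  simp only [mul_one] at h
  rw [h, one_mul]

lemma cE_mono {n : ℕ} {q : Sym2 (Fin n) → ℝ} (h0 : ∀ e, 0 ≤ q e) (h1 : ∀ e, q e ≤ 1)
    {F F' : (Sym2 (Fin n) → Bool) → ℝ} (h : ∀ f, F f ≤ F' f) : cE q F ≤ cE q F' := by
  unfold cE
  exact Finset.sum_le_sum fun f _ => mul_le_mul_of_nonneg_left (h f) (cW_nonneg h0 h1 f)

lemma cE_sum {n : ℕ} {ι : Type*} (q : Sym2 (Fin n) → ℝ) (s : Finset ι)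
    (F : ι → (Sym2 (Fin n) → Bool) → ℝ) :
    cE q (fun f => ∑ i ∈ s, F i f) = ∑ i ∈ s, cE q (F i) := by
  unfold cE
  rw [Finset.sum_comm]
  simp only [Finset.mul_sum]

lemma cE_mul {n : ℕ} (q : Sym2 (Fin n) → ℝ) (c : ℝ) (F : (Sym2 (Fin n) → Bool) → ℝ) :
    cE q (fun f => c * F f) = c * cE q F := by
  unfold cE
  rw [Finset.mul_sum]
  exact Finset.sum_congr rfl fun f _ => by ring

lemma cE_add {n : ℕ} (q : Sym2 (Fin n) → ℝ) (F F' : (Sym2 (Fin n) → Bool) → ℝ) :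
    cE q (fun f => F f + F' f) = cE q F + cE q F' := by
  unfold cE
  rw [← Finset.sum_add_distrib]
  exact Finset.sum_congr rfl fun f _ => by ring

lemma cE_sub {n : ℕ} (q : Sym2 (Fin n) → ℝ) (F F' : (Sym2 (Fin n) → Bool) → ℝ) :
    cE q (fun f => F f - F' f) = cE q F - cE q F' := by
  unfold cE
  rw [← Finset.sum_sub_distrib]
  exact Finset.sum_congr rfl fun f _ => by ring

lemma cE_exp {n : ℕ} {q : Sym2 (Fin n) → ℝ} (h0 : ∀ e, 0 ≤ q e) (h1 : ∀ e, q e ≤ 1)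
    (c : Sym2 (Fin n) → ℝ) :
    cE q (fun f => Real.exp (∑ e, if f e then c e else 0)) ≤
      Real.exp (∑ e, q e * (Real.exp (c e) - 1)) := by
  have h := cE_prod q (fun e x => Real.exp (if x then c e else 0))
  simp only [← Real.exp_sum] at h
  rw [h, Real.exp_sum]
  refine Finset.prod_le_prod (fun e _ => ?_) (fun e _ => ?_)
  · have := h0 e; have := h1 e
    have h3 : 0 ≤ 1 - q e := by linarith
    positivity
  · have := Real.add_one_le_exp (q e * (Real.exp (c e) - 1))
    simp
    linarith

lemma cE_chernoff {n : ℕ} {q : Sym2 (Fin n) → ℝ} (h0 : ∀ e, 0 ≤ q e) (h1 : ∀ e, q e ≤ 1)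
    (c : Sym2 (Fin n) → ℝ) (L : ℝ) :
    cE q (fun f => if L ≤ ∑ e, (if f e then c e else 0) then 1 else 0) ≤
      Real.exp (∑ e, q e * (Real.exp (c e) - 1) - L) := by
  rw [sub_eq_neg_add, Real.exp_add]
  refine le_trans ?_ (mul_le_mul_of_nonneg_left (cE_exp h0 h1 c) (Real.exp_pos _).le)
  rw [← cE_mul]
  refine cE_mono h0 h1 fun f => ?_
  split_ifs with h
  · rw [← Real.exp_add]
    exact Real.one_le_exp (by linarith)
  · positivity

/-- Number of edges weighted incidence. -/
lemma chern_deg {n : ℕ} {q : Sym2 (Fin n) → ℝ} (h0 : ∀ e, 0 ≤ q e) (h1 : ∀ e, q e ≤ 1)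
    (A R : Finset (Fin n)) (β t L M : ℝ)
    (hq : ∀ v ∈ A, ∀ u ∈ R, v ≠ u → q s(v, u) = β)
    (hM : β * (∑ v ∈ A, ∑ u ∈ R, if v ≠ u then (1:ℝ) else 0) * ((Real.exp (2 * t) - 1) / 2) ≤ M) :
    cE q (fun f => if L ≤ t * ∑ v ∈ A, ∑ u ∈ R, (if (graphOfConfig f).Adj v u then (1:ℝ) else 0)
      then 1 else 0) ≤ Real.exp (M - L) := by
  set P : Finset (Fin n × Fin n) := (A ×ˢ R).filter (fun x => x.1 ≠ x.2) with hP
  set k : Sym2 (Fin n) → ℕ := fun e => (P.filter (fun x => s(x.1, x.2) = e)).card with hk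
  have hk2 : ∀ e, k e ≤ 2 := by
    intro e
    induction e with
    | _ x y =>
      calc k s(x, y) ≤ ({(x, y), (y, x)} : Finset (Fin n × Fin n)).card := by
            apply Finset.card_le_card
            intro z hz
            simp only [Finset.mem_filter] at hz
            have := hz.2
            rw [Sym2.eq_iff] at this
            simp only [Finset.mem_insert, Finset.mem_singleton, Prod.ext_iff]
            tauto
        _ ≤ 2 := Finset.card_le_two
  have hsum : ∀ F : Sym2 (Fin n) → ℝ, ∑ e, (k e : ℝ) * F e = ∑ x ∈ P, F s(x.1, x.2) := by
    intro F
    rw [← Finset.sum_fiberwise (s := P) (g := fun x => s(x.1, x.2))]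
    refine Finset.sum_congr rfl fun e _ => ?_
    rw [Finset.sum_congr rfl (g := fun _ => F e)]
    · simp [hk]
    · intro x hx
      rw [(Finset.mem_filter.1 hx).2]
  have hdeg : ∀ f : Sym2 (Fin n) → Bool,
      t * ∑ v ∈ A, ∑ u ∈ R, (if (graphOfConfig f).Adj v u then (1:ℝ) else 0) =
      ∑ e, (if f e then t * (k e : ℝ) else 0) := by
    intro f
    have : ∀ e, (if f e then t * (k e : ℝ) else 0) = (k e : ℝ) * (if f e then t else 0) := by
      intro e; split_ifs <;> ring
    simp only [this]
    rw [hsum, hP, Finset.sum_filter, ← Finset.sum_product', Finset.mul_sum]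
    refine Finset.sum_congr rfl fun x _ => ?_
    have : (graphOfConfig f).Adj x.1 x.2 ↔ x.1 ≠ x.2 ∧ f s(x.1, x.2) = true := by
      simp [graphOfConfig, SimpleGraph.fromRel_adj, Sym2.eq_swap (a := x.2)]
    simp only [this]
    by_cases h1 : x.1 = x.2 <;> by_cases h2 : f s(x.1, x.2) = true <;> simp [h1, h2] 
    
  simp only [hdeg]
  refine (cE_chernoff h0 h1 _ L).trans ?_
  apply Real.exp_le_exp.2
  have key : ∑ e, q e * (Real.exp (t * (k e : ℝ)) - 1) ≤
      ∑ e, (k e : ℝ) * (q e * ((Real.exp (2 * t) - 1) / 2)) := by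
    refine Finset.sum_le_sum fun e _ => ?_
    have : Real.exp (t * (k e : ℝ)) - 1 ≤ (k e : ℝ) * ((Real.exp (2 * t) - 1) / 2) := by
      have := hk2 e
      have h2 : Real.exp (2 * t) = Real.exp t ^ 2 := by rw [← Real.exp_nat_mul]; norm_num
      interval_cases h : k e
      · simp
      · rw [h2]; norm_num; nlinarith [sq_nonneg (Real.exp t - 1)]
      · rw [mul_comm t]; norm_num; linarith
    calc _ ≤ q e * ((k e : ℝ) * ((Real.exp (2 * t) - 1) / 2)) :=
          mul_le_mul_of_nonneg_left this (h0 e)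
      _ = _ := by ring
  have key2 : ∑ e, (k e : ℝ) * (q e * ((Real.exp (2 * t) - 1) / 2)) =
      β * (∑ v ∈ A, ∑ u ∈ R, if v ≠ u then (1:ℝ) else 0) * ((Real.exp (2 * t) - 1) / 2) := by
    rw [hsum, ← Finset.sum_product', Finset.mul_sum, Finset.sum_mul, hP, Finset.sum_filter]
    refine Finset.sum_congr rfl fun x hx => ?_
    rw [Finset.mem_product] at hx
    split_ifs with h
    · rw [hq _ hx.1 _ hx.2 h]; ring
    · ring
  linarith

lemma cE_indep {n : ℕ} (q : Sym2 (Fin n) → ℝ) (e : Sym2 (Fin n))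
    (Y : (Sym2 (Fin n) → Bool) → ℝ) :
    cE q (fun f => (if f e then 1 else 0) * Y (Function.update f e false)) =
      q e * cE q (fun f => Y (Function.update f e false)) := by
  rw [← cE_mul, ← sub_eq_zero, ← cE_sub]
  unfold cE
  refine Finset.sum_involution (fun f _ => Function.update f e (!f e)) ?_ ?_ ?_ ?_
  · intro f _
    have hw : ∀ f, configWeight q f = (if f e then q e else 1 - q e) *
        ∏ x ∈ Finset.univ.erase e, (if f x then q x else 1 - q x) := by
      intro f
      unfold configWeight
      rw [Finset.mul_prod_erase _ (fun x => if f x then q x else 1 - q x) (Finset.mem_univ e)]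
    have hr : ∏ x ∈ Finset.univ.erase e,
        (if (Function.update f e (!f e)) x then q x else 1 - q x) =
        ∏ x ∈ Finset.univ.erase e, (if f x then q x else 1 - q x) := by
      refine Finset.prod_congr rfl fun x hx => ?_
      rw [Function.update_of_ne (Finset.ne_of_mem_erase hx)]
    rw [hw, hw (Function.update f e (!f e)), hr]
    simp only [Function.update_idem, Function.update_self]
    cases f e <;> simp <;> ring
  · intro f _ _ h
    have := congrFun h e
    simp at this
  · intro f _; simp
  · intro f _; simp

lemma goc_adj {n : ℕ} (f : Sym2 (Fin n) → Bool) (x y : Fin n) :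
    (graphOfConfig f).Adj x y ↔ x ≠ y ∧ f s(x, y) = true := by
  simp [graphOfConfig, SimpleGraph.fromRel_adj, Sym2.eq_swap (a := y)]

/-- `v` is infected from `S`. -/
def infd {n : ℕ} (S : Finset (Fin n)) (f : Sym2 (Fin n) → Bool) (v : Fin n) : Prop :=
  ∃ u ∈ S, (graphOfConfig f).Reachable u v

lemma infd_step {n : ℕ} {S : Finset (Fin n)} {f : Sym2 (Fin n) → Bool} {w : Fin n}
    (hw : w ∉ S) (h : infd S f w) :
    ∃ u, u ≠ w ∧ f s(u, w) = true ∧ infd S (Function.update f s(u, w) false) u := by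
  obtain ⟨u0, hu0, hr⟩ := h
  obtain ⟨P, hP⟩ := hr.symm.exists_isPath
  cases P with
  | nil => exact absurd hu0 hw
  | @cons _ v _ hadj p' =>
    rw [SimpleGraph.Walk.cons_isPath_iff] at hP
    rw [goc_adj] at hadj
    refine ⟨v, hadj.1.symm, by rw [Sym2.eq_swap]; exact hadj.2, u0, hu0, ?_⟩
    refine (SimpleGraph.Walk.reachable (p'.transfer _ ?_)).symm
    intro e he
    induction e with
    | _ x y =>
      have h1 := p'.edges_subset_edgeSet he
      rw [SimpleGraph.mem_edgeSet, goc_adj] at *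
      refine ⟨h1.1, ?_⟩
      rw [Function.update_of_ne]
      · exact h1.2
      · intro h
        rw [h] at he
        exact hP.2 (p'.snd_mem_support_of_mem_edges he)

lemma infd_mono {n : ℕ} {S : Finset (Fin n)} {f : Sym2 (Fin n) → Bool} {e : Sym2 (Fin n)}
    {w : Fin n} (h : infd S (Function.update f e false) w) : infd S f w := by
  obtain ⟨u, hu, hr⟩ := h
  refine ⟨u, hu, hr.mono ?_⟩
  intro x y hxy
  rw [goc_adj] at *
  refine ⟨hxy.1, ?_⟩
  by_cases h : s(x, y) = e
  · rw [h] at hxy; simp at hxy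
  · rw [Function.update_of_ne h] at hxy; exact hxy.2

lemma clusterSize_eq {n : ℕ} (S : Finset (Fin n)) (f : Sym2 (Fin n) → Bool) :
    (clusterSize (graphOfConfig f) S : ℝ) = ∑ v, if infd S f v then (1:ℝ) else 0 := by
  have h : {v : Fin n | ∃ u ∈ S, (graphOfConfig f).Reachable u v} =
      ((Finset.univ.filter (fun v => infd S f v) : Finset (Fin n)) : Set (Fin n)) := by
    ext v
    rw [Finset.mem_coe, Finset.mem_filter]
    exact ⟨fun h => ⟨Finset.mem_univ _, h⟩, fun h => h.2⟩
  unfold clusterSize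
  rw [h, Set.ncard_coe_finset, Finset.sum_boole]

/-- percolation edge probabilities -/
noncomputable def pq {n : ℕ} (G : SimpleGraph (Fin n)) (p : ℝ) : Sym2 (Fin n) → ℝ :=
  fun e => if e ∈ G.edgeSet then p else 0

lemma pq0 {n : ℕ} (G : SimpleGraph (Fin n)) {p : ℝ} (h : 0 ≤ p) (e) : 0 ≤ pq G p e := by
  unfold pq; split_ifs <;> simp [h]

lemma pq1 {n : ℕ} (G : SimpleGraph (Fin n)) {p : ℝ} (h : p ≤ 1) (e) : pq G p e ≤ 1 := by
  unfold pq; split_ifs <;> simp [h]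

/-- infection probability -/
noncomputable def xv {n : ℕ} (G : SimpleGraph (Fin n)) (p : ℝ) (S : Finset (Fin n))
    (v : Fin n) : ℝ := cE (pq G p) (fun f => if infd S f v then (1:ℝ) else 0)

lemma percExp_eq {n : ℕ} (G : SimpleGraph (Fin n)) (p : ℝ) (S : Finset (Fin n)) :
    percExp G p (fun H => (clusterSize H S : ℝ)) = ∑ v, xv G p S v := by
  unfold xv
  rw [← cE_sum]
  unfold percExp irgExp cE pq
  simp only [clusterSize_eq]

lemma xv_nonneg {n : ℕ} (G : SimpleGraph (Fin n)) {p : ℝ} (h0 : 0 ≤ p) (h1 : p ≤ 1)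
    (S : Finset (Fin n)) (v : Fin n) : 0 ≤ xv G p S v := by
  rw [← cE_const (pq G p) 0]
  exact cE_mono (pq0 G h0) (pq1 G h1) fun f => by split_ifs <;> norm_num

lemma xv_le_one {n : ℕ} (G : SimpleGraph (Fin n)) {p : ℝ} (h0 : 0 ≤ p) (h1 : p ≤ 1)
    (S : Finset (Fin n)) (v : Fin n) : xv G p S v ≤ 1 := by
  rw [← cE_const (pq G p) 1]
  exact cE_mono (pq0 G h0) (pq1 G h1) fun f => by split_ifs <;> norm_num

lemma xv_step {n : ℕ} (G : SimpleGraph (Fin n)) {p : ℝ} (h0 : 0 ≤ p) (h1 : p ≤ 1)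
    (S : Finset (Fin n)) (w : Fin n) (hw : w ∉ S) :
    xv G p S w ≤ ∑ u, (if G.Adj w u then p else 0) * xv G p S u := by
  have hA : xv G p S w ≤ cE (pq G p) (fun f => ∑ u, if u ≠ w then
      (if f s(u, w) then (1:ℝ) else 0) *
        (if infd S (Function.update f s(u, w) false) u then (1:ℝ) else 0) else 0) := by
    refine cE_mono (pq0 G h0) (pq1 G h1) fun f => ?_
    have hnn : ∀ u ∈ Finset.univ, (0:ℝ) ≤ if u ≠ w then (if f s(u, w) then (1:ℝ) else 0) *
        (if infd S (Function.update f s(u, w) false) u then (1:ℝ) else 0) else 0 := by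
      intro u _
      split_ifs <;> norm_num
    split_ifs with h
    · obtain ⟨u, hu1, hu2, hu3⟩ := infd_step hw h
      refine le_trans ?_ (Finset.single_le_sum hnn (Finset.mem_univ u))
      simp [hu1, hu2, hu3]
    · exact Finset.sum_nonneg hnn
  refine hA.trans ?_
  rw [cE_sum]
  refine Finset.sum_le_sum fun u _ => ?_
  by_cases hu : u = w
  · subst hu
    simp [cE_const]
  · simp only [ne_eq, hu, not_false_eq_true, if_true]
    rw [cE_indep (pq G p) s(u, w) (fun f => if infd S f u then (1:ℝ) else 0)]
    have hq : pq G p s(u, w) = if G.Adj w u then p else 0 := by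
      unfold pq
      simp only [SimpleGraph.mem_edgeSet, SimpleGraph.adj_comm]
    rw [hq]
    refine mul_le_mul_of_nonneg_left ?_ (by split_ifs <;> simp [h0])
    refine cE_mono (pq0 G h0) (pq1 G h1) fun f => ?_
    by_cases h : infd S (Function.update f s(u, w) false) u
    · simp [h, infd_mono h]
    · simp only [h, if_false]; split_ifs <;> norm_num

lemma central_upper {n : ℕ} (G : SimpleGraph (Fin n)) {b : ℝ} (hb : 1 ≤ b)
    (U S : Finset (Fin n)) (hS : S ⊆ U)
    (hUW : ∑ w ∈ Uᶜ, ∑ u ∈ U, (if G.Adj w u then (1:ℝ) else 0) ≤ 0.256 * b * n)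
    (hWW : ∀ A ⊆ Uᶜ, ∑ w ∈ A, ∑ u ∈ Uᶜ, (if G.Adj w u then (1:ℝ) else 0)
      ≤ 0.51 * b * A.card + 0.001 * b * n) :
    percExp G (1 / (4 * b)) (fun H => (clusterSize H S : ℝ)) ≤ U.card + 0.074 * n := by
  rw [percExp_eq, ← Finset.sum_add_sum_compl U]
  set p := 1 / (4 * b) with hp
  have hb0 : 0 < b := by linarith
  have h0 : 0 ≤ p := by positivity
  have h1 : p ≤ 1 := by rw [hp, div_le_one (by positivity)]; linarith
  have hpb : p * b = 1 / 4 := by rw [hp]; field_simp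
  set x := xv G p S with hx
  have hx0 : ∀ v, 0 ≤ x v := xv_nonneg G h0 h1 S
  have hx1 : ∀ v, x v ≤ 1 := xv_le_one G h0 h1 S
  set X := ∑ w ∈ Uᶜ, x w with hX
  have hU : ∑ v ∈ U, x v ≤ U.card := by
    calc _ ≤ ∑ v ∈ U, (1:ℝ) := Finset.sum_le_sum fun v _ => hx1 v
      _ = _ := by simp
  set d : Fin n → ℝ := fun w => ∑ u ∈ Uᶜ, (if G.Adj w u then (1:ℝ) else 0) with hd
  have hXle : X ≤ p * (∑ w ∈ Uᶜ, ∑ u ∈ U, (if G.Adj w u then (1:ℝ) else 0)) +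
      p * ∑ u ∈ Uᶜ, x u * d u := by
    have e1 : ∑ u ∈ Uᶜ, x u * d u =
        ∑ w ∈ Uᶜ, ∑ u ∈ Uᶜ, (if G.Adj w u then (1:ℝ) else 0) * x u := by
      rw [Finset.sum_comm]
      refine Finset.sum_congr rfl fun u _ => ?_
      rw [hd, Finset.mul_sum]
      refine Finset.sum_congr rfl fun w _ => ?_
      rw [G.adj_comm, mul_comm]
    rw [e1, ← mul_add, ← Finset.sum_add_distrib, Finset.mul_sum]
    refine Finset.sum_le_sum fun w hw => ?_
    have hwS : w ∉ S := fun h => (Finset.mem_compl.1 hw) (hS h)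
    refine (xv_step G h0 h1 S w hwS).trans ?_
    rw [← Finset.sum_add_sum_compl U, mul_add, Finset.mul_sum, Finset.mul_sum]
    refine add_le_add (Finset.sum_le_sum fun u _ => ?_) (Finset.sum_le_sum fun u _ => ?_)
    · have := hx1 u
      split_ifs
      · simp only [mul_one]; exact mul_le_of_le_one_right h0 this
      · simp
    · apply le_of_eq
      split_ifs <;> simp [hx]
  have hdx : ∑ u ∈ Uᶜ, x u * d u ≤ 0.51 * b * X + 0.001 * b * n := by
    set A := Uᶜ.filter (fun w => 0.51 * b < d w) with hA
    have h2 := hWW A (Finset.filter_subset _ _)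
    have h3 : ∑ u ∈ Uᶜ, x u * (d u - 0.51 * b) ≤ ∑ u ∈ A, (d u - 0.51 * b) := by
      rw [hA, Finset.sum_filter]
      refine Finset.sum_le_sum fun u _ => ?_
      split_ifs with h
      · exact mul_le_of_le_one_left (by linarith) (hx1 u)
      · exact mul_nonpos_of_nonneg_of_nonpos (hx0 u) (by linarith)
    rw [Finset.sum_sub_distrib] at h3
    simp only [mul_sub] at h3
    rw [Finset.sum_sub_distrib, ← Finset.sum_mul, Finset.sum_const, nsmul_eq_mul] at h3
    have : X * (0.51 * b) = 0.51 * b * X := by ring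
    rw [← hX] at h3
    change ∑ w ∈ A, d w ≤ _ at h2
    linarith
  have a1 := mul_le_mul_of_nonneg_left hUW h0
  have a2 := mul_le_mul_of_nonneg_left hdx h0
  have a3 : p * (0.256 * b * n) = 0.064 * n := by
    calc _ = 0.256 * (p * b) * n := by ring
      _ = _ := by rw [hpb]; ring
  have a4 : p * (0.51 * b * X + 0.001 * b * n) = 0.1275 * X + 0.00025 * n := by
    calc _ = 0.51 * (p * b) * X + 0.001 * (p * b) * n := by ring
      _ = _ := by rw [hpb]; ring
  have hn : (0:ℝ) ≤ n := Nat.cast_nonneg n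
  linarith

lemma choose_avoid (n s k : ℕ) (hs : s ≤ n) (hk : k ≤ n) :
    ((n - k).choose s : ℝ) ≤ (1 - (s:ℝ) / n) ^ k * (n.choose s : ℝ) := by
  induction k with
  | zero => simp
  | succ k ih =>
    have ih := ih (by omega)
    have hn0 : (0:ℝ) < n := by exact_mod_cast (by omega : 0 < n)
    obtain ⟨m, hm⟩ : ∃ m, n - k = m + 1 := ⟨n - k - 1, by omega⟩
    have e1 : n - (k + 1) = m := by omega
    rw [e1]
    rw [hm] at ih
    have hr : 0 ≤ 1 - (s:ℝ) / n := by
      rw [sub_nonneg, div_le_one hn0]; exact_mod_cast hs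
    suffices h : (m.choose s : ℝ) ≤ (1 - (s:ℝ) / n) * ((m+1).choose s : ℝ) by
      calc _ ≤ _ := h
        _ ≤ (1 - (s:ℝ) / n) * ((1 - (s:ℝ) / n) ^ k * (n.choose s : ℝ)) :=
          mul_le_mul_of_nonneg_left ih hr
        _ = _ := by ring
    by_cases hsm : s ≤ m
    · have h2 := Nat.choose_mul_succ_eq m s
      have h3 : (m.choose s : ℝ) * (m + 1) = ((m+1).choose s : ℝ) * (m + 1 - s) := by
        have : ((m + 1 - s : ℕ) : ℝ) = (m:ℝ) + 1 - s := by
          rw [Nat.cast_sub (by omega)]; push_cast; ring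
        rw [← this]
        exact_mod_cast h2
      have hmn : (m:ℝ) + 1 ≤ n := by exact_mod_cast (by omega : m + 1 ≤ n)
      have hm0 : (0:ℝ) < (m:ℝ) + 1 := by positivity
      have h4 : (m.choose s : ℝ) = (1 - (s:ℝ) / (m+1)) * ((m+1).choose s : ℝ) := by
        field_simp
        linarith
      rw [h4]
      have : (s:ℝ) / n ≤ (s:ℝ) / (m+1) := by gcongr
      exact mul_le_mul_of_nonneg_right (by linarith) (by positivity)
    · rw [Nat.choose_eq_zero_of_lt (by omega)]
      push_cast
      positivity

lemma avoid_count {n : ℕ} (s : ℕ) (hs : s ≤ n) (T : Finset (Fin n)) :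
    ((∑ S ∈ Finset.powersetCard s (Finset.univ : Finset (Fin n)),
      if Disjoint S T then (1:ℝ) else 0)) ≤ (1 - (s:ℝ) / n) ^ T.card * (n.choose s : ℝ) := by
  have hT : T.card ≤ n := by simpa using Finset.card_le_univ T
  refine le_trans (le_of_eq ?_) (choose_avoid n s T.card hs hT)
  have : (Finset.powersetCard s (Finset.univ : Finset (Fin n))).filter (fun S => Disjoint S T)
      = Finset.powersetCard s Tᶜ := by
    ext S
    simp only [Finset.mem_filter, Finset.mem_powersetCard, Finset.subset_univ, true_and,
      Finset.subset_compl_iff_disjoint_right]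
    tauto
  rw [← Finset.sum_filter, this]
  simp [Finset.card_powersetCard, Finset.card_compl]

lemma cE_pow_deg {n : ℕ} (G : SimpleGraph (Fin n)) (p r : ℝ) (U : Finset (Fin n)) (v : Fin n) :
    cE (pq G p) (fun f => r ^ (U.filter (fun u => (graphOfConfig f).Adj v u)).card) =
      (1 - p * (1 - r)) ^ (U.filter (fun u => G.Adj v u)).card := by
  set I : Finset (Sym2 (Fin n)) := (U.erase v).image (fun u => s(v, u)) with hI
  have hinj : Set.InjOn (fun u => s(v, u)) (U.erase v : Finset (Fin n)) := by
    intro x _ y _ h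
    simp at h
    rcases h with h | ⟨h1, h2⟩
    · exact h
    · rw [h2, h1]
  have hprod : ∀ F : Sym2 (Fin n) → ℝ,
      ∏ e, (if e ∈ I then F e else 1) = ∏ u ∈ U.erase v, F s(v, u) := by
    intro F
    rw [Finset.prod_ite_mem, Finset.univ_inter, hI, Finset.prod_image hinj]
  have hpow : ∀ (c : ℝ) (P : Fin n → Prop), ¬ P v →
      c ^ (U.filter P).card = ∏ u ∈ U.erase v, if P u then c else 1 := by
    intro c P hP
    rw [← Finset.prod_filter, Finset.prod_const]
    congr 2
    ext u
    simp only [Finset.mem_filter, Finset.mem_erase]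
    constructor
    · rintro ⟨h1, h2⟩
      exact ⟨⟨fun h => hP (h ▸ h2), h1⟩, h2⟩
    · rintro ⟨⟨_, h1⟩, h2⟩
      exact ⟨h1, h2⟩
  have h := cE_prod (pq G p) (fun e x => if e ∈ I then (if x then r else 1) else 1)
  have hl : ∀ f : Sym2 (Fin n) → Bool,
      r ^ (U.filter (fun u => (graphOfConfig f).Adj v u)).card =
      ∏ e, (if e ∈ I then (if f e then r else 1) else 1) := by
    intro f
    rw [hprod (fun e => if f e then r else 1), hpow _ _ (by simp)]
    refine Finset.prod_congr rfl fun u hu => ?_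
    rw [Finset.mem_erase] at hu
    simp [goc_adj, Ne.symm hu.1]
  simp only [hl]
  rw [h, hpow _ _ (by simp)]
  have e2 : ∀ e, pq G p e * (if e ∈ I then (if (true : Bool) = true then r else 1) else 1) +
      (1 - pq G p e) * (if e ∈ I then (if (false : Bool) = true then r else 1) else 1) =
      if e ∈ I then 1 - pq G p e * (1 - r) else 1 := by
    intro e
    split_ifs <;> simp_all <;> ring
  rw [Finset.prod_congr rfl fun e _ => e2 e]
  rw [hprod (fun e => 1 - pq G p e * (1 - r))]
  refine Finset.prod_congr rfl fun u hu => ?_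
  unfold pq
  simp only [SimpleGraph.mem_edgeSet]
  split_ifs <;> ring

lemma uniform_lower {n : ℕ} (G : SimpleGraph (Fin n)) {p : ℝ} (h0 : 0 ≤ p) (h1 : p ≤ 1)
    (U : Finset (Fin n)) (s : ℕ) (hs : s ≤ n) :
    (n:ℝ) - Uᶜ.card * (1 - (s:ℝ)/n) -
      ∑ v ∈ U, (1 - p * ((s:ℝ)/n)) ^ (U.filter (fun u => G.Adj v u)).card ≤
    seedPercExp G p Finset.univ s := by
  set r : ℝ := 1 - (s:ℝ)/n with hr
  have hC : (0:ℝ) < n.choose s := by exact_mod_cast Nat.choose_pos hs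
  unfold seedPercExp
  rw [Finset.card_powersetCard, Finset.card_univ, Fintype.card_fin, le_div_iff₀ hC]
  have e1 : ∑ S ∈ Finset.powersetCard s (Finset.univ : Finset (Fin n)),
      percExp G p (fun H => (clusterSize H S : ℝ)) =
      cE (pq G p) (fun f => ∑ S ∈ Finset.powersetCard s (Finset.univ : Finset (Fin n)),
        (clusterSize (graphOfConfig f) S : ℝ)) := by
    rw [cE_sum]; rfl
  rw [e1]
  have e2 : ∀ f : Sym2 (Fin n) → Bool,
      ((n:ℝ) - Uᶜ.card * r) * (n.choose s) - (n.choose s) *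
        (∑ v ∈ U, r ^ (U.filter (fun u => (graphOfConfig f).Adj v u)).card) ≤
      ∑ S ∈ Finset.powersetCard s (Finset.univ : Finset (Fin n)),
        (clusterSize (graphOfConfig f) S : ℝ) := by
    intro f
    have hv : ∀ (v : Fin n) (T : Finset (Fin n)), (∀ u ∈ T, (graphOfConfig f).Reachable u v) →
        (n.choose s : ℝ) - r ^ T.card * n.choose s ≤
        ∑ S ∈ Finset.powersetCard s (Finset.univ : Finset (Fin n)),
          if infd S f v then (1:ℝ) else 0 := by
      intro v T hT
      have h := avoid_count s hs T
      have h2 : (n.choose s : ℝ) =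
          ∑ S ∈ Finset.powersetCard s (Finset.univ : Finset (Fin n)), (1:ℝ) := by simp
      have h3 : ∑ S ∈ Finset.powersetCard s (Finset.univ : Finset (Fin n)), (1:ℝ) -
          (∑ S ∈ Finset.powersetCard s (Finset.univ : Finset (Fin n)),
            if Disjoint S T then (1:ℝ) else 0) ≤
          ∑ S ∈ Finset.powersetCard s (Finset.univ : Finset (Fin n)),
          if infd S f v then (1:ℝ) else 0 := by
        rw [← Finset.sum_sub_distrib]
        refine Finset.sum_le_sum fun S _ => ?_
        by_cases hd : Disjoint S T
        · simp only [hd, if_true]; split_ifs <;> norm_num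
        · have : infd S f v := by
            rw [Finset.not_disjoint_iff] at hd
            obtain ⟨u, hu1, hu2⟩ := hd
            exact ⟨u, hu1, hT u hu2⟩
          simp [hd, this]
      rw [← h2] at h3
      linarith
    simp only [clusterSize_eq]
    rw [Finset.sum_comm, ← Finset.sum_add_sum_compl U]
    have b1 := Finset.sum_le_sum (s := U) fun v _ =>
      hv v (U.filter (fun u => (graphOfConfig f).Adj v u)) (by
        intro u hu
        exact (Finset.mem_filter.1 hu).2.symm.reachable)
    have b2 := Finset.sum_le_sum (s := Uᶜ) fun v _ => hv v {v} (by
        intro u hu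
        rw [Finset.mem_singleton.1 hu])
    refine le_trans (le_of_eq ?_) (add_le_add b1 b2)
    have hc : (n:ℝ) = U.card + Uᶜ.card := by
      have := Finset.card_add_card_compl U
      rw [Fintype.card_fin] at this
      exact_mod_cast this.symm
    simp only [Finset.sum_sub_distrib, Finset.sum_const, nsmul_eq_mul, Finset.card_singleton,
      pow_one, ← Finset.sum_mul]
    rw [hc]
    ring
  refine le_trans (le_of_eq ?_) (cE_mono (pq0 G h0) (pq1 G h1) e2)
  rw [cE_sub, cE_const, cE_mul, cE_sum]
  simp only [cE_pow_deg]
  have : 1 - r = (s:ℝ)/n := by rw [hr]; ring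
  rw [this]
  ring

lemma exp_const_small : Real.exp (-(4.7:ℝ)) ≤ 0.01 := by
  have h1 : (2.718:ℝ) ≤ Real.exp 1 := by linarith [Real.exp_one_gt_d9]
  have h2 := Real.quadratic_le_exp_of_nonneg (x := (0.7:ℝ)) (by norm_num)
  have h3 : Real.exp (4.7:ℝ) = Real.exp 1 ^ 4 * Real.exp 0.7 := by
    rw [← Real.exp_nat_mul, ← Real.exp_add]; norm_num
  have h4 : (2.718:ℝ) ^ 4 * 1.945 ≤ Real.exp 4.7 := by
    rw [h3]
    gcongr
    linarith
  rw [Real.exp_neg]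
  have : (100:ℝ) ≤ Real.exp 4.7 := by
    refine le_trans ?_ h4
    norm_num
  calc (Real.exp 4.7)⁻¹ ≤ (100:ℝ)⁻¹ := inv_anti₀ (by norm_num) this
    _ = 0.01 := by norm_num

lemma central_card (n : ℕ) : (centralSet n).card = n / 2 := by
  unfold centralSet
  rw [Fin.card_filter_val_lt]
  omega

lemma det_part {n : ℕ} (hn : 1000 ≤ n) (hev : Even n) {b : ℝ} (hb : 1 ≤ b)
    (G : SimpleGraph (Fin n))
    (g1 : ∀ A ⊆ centralSet n, 0.001 * (n:ℝ) ≤ A.card → 58 * b * A.card <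
      ∑ v ∈ A, ∑ u ∈ centralSet n, (if G.Adj v u then (1:ℝ) else 0))
    (g2 : ∀ A ⊆ (centralSet n)ᶜ,
      ∑ w ∈ A, ∑ u ∈ (centralSet n)ᶜ, (if G.Adj w u then (1:ℝ) else 0)
      ≤ 0.51 * b * A.card + 0.001 * b * n)
    (g3 : ∑ w ∈ (centralSet n)ᶜ, ∑ u ∈ centralSet n, (if G.Adj w u then (1:ℝ) else 0)
      ≤ 0.256 * b * n) :
    seedPercExp G (1 / (4 * b)) (centralSet n) (n / 3)
              ≤ (11 / 12) * seedPercExp G (1 / (4 * b)) Finset.univ (n / 3) ∧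
          ((n / 3 : ℕ) : ℝ) / 4 ≤
            seedPercExp G (1 / (4 * b)) Finset.univ (n / 3)
              - seedPercExp G (1 / (4 * b)) (centralSet n) (n / 3) := by
  set U := centralSet n with hU
  set p := 1 / (4 * b) with hp
  set s := n / 3 with hs
  have hb0 : 0 < b := by linarith
  have h0 : 0 ≤ p := by positivity
  have h1 : p ≤ 1 := by rw [hp, div_le_one (by positivity)]; linarith
  have hpb : p * b = 1 / 4 := by rw [hp]; field_simp
  obtain ⟨m, hm⟩ := hev
  have hUc : U.card = m := by rw [hU, central_card]; omega
  have hnm : (n:ℝ) = 2 * m := by rw [hm]; push_cast; ring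
  have hWc : Uᶜ.card = m := by
    rw [Finset.card_compl, Fintype.card_fin, hUc]; omega
  have hn' : (1000:ℝ) ≤ n := by exact_mod_cast hn
  have hn0 : (0:ℝ) < n := by linarith
  have hs1 : (n:ℝ) ≤ 3 * s + 2 := by exact_mod_cast (by omega : n ≤ 3 * s + 2)
  have hs2 : 3 * (s:ℝ) ≤ n := by exact_mod_cast (by omega : 3 * s ≤ n)
  have hsn : s ≤ n := by omega
  -- upper bound for central seeding
  have hup : seedPercExp G p U s ≤ m + 0.074 * n := by
    unfold seedPercExp
    have hc : (0:ℝ) < ((Finset.powersetCard s U).card : ℝ) := by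
      rw [Finset.card_powersetCard, hUc]
      exact_mod_cast Nat.choose_pos (by omega)
    rw [div_le_iff₀ hc, mul_comm, ← nsmul_eq_mul]
    refine Finset.sum_le_card_nsmul _ _ _ fun S hS => ?_
    have := central_upper G hb U S (Finset.mem_powersetCard.1 hS).1 g3 g2
    rw [hUc] at this
    exact this
  -- lower bound for uniform seeding
  have hlow := uniform_lower G h0 h1 U s hsn
  rw [hWc] at hlow
  have hsn33 : 0.33 ≤ (s:ℝ) / n := by
    rw [le_div_iff₀ hn0]; linarith
  have hsn1 : (s:ℝ) / n ≤ 1 := by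
    rw [div_le_one hn0]; linarith
  have hY : ∑ v ∈ U, (1 - p * ((s:ℝ)/n)) ^ (U.filter (fun u => G.Adj v u)).card ≤ 0.006 * n := by
    set dd : Fin n → ℝ := fun v => ∑ u ∈ U, (if G.Adj v u then (1:ℝ) else 0) with hdd
    set L := U.filter (fun v => dd v < 58 * b) with hL
    have hLc : (L.card : ℝ) < 0.001 * n := by
      by_contra hcon
      push Not at hcon
      have h2 := g1 L (Finset.filter_subset _ _) hcon
      have h3 : ∑ v ∈ L, dd v ≤ ∑ v ∈ L, 58 * b :=
        Finset.sum_le_sum fun v hv => (Finset.mem_filter.1 hv).2.le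
      rw [Finset.sum_const, nsmul_eq_mul] at h3
      change _ < ∑ v ∈ L, dd v at h2
      linarith
    have hx0 : 0 ≤ 1 - p * ((s:ℝ)/n) := by
      have : p * ((s:ℝ)/n) ≤ 1 * 1 := by gcongr
      linarith
    have hx1 : 1 - p * ((s:ℝ)/n) ≤ 1 := by
      have : 0 ≤ p * ((s:ℝ)/n) := by positivity
      linarith
    have hterm : ∀ v ∈ U, (1 - p * ((s:ℝ)/n)) ^ (U.filter (fun u => G.Adj v u)).card ≤
        (if dd v < 58 * b then 1 else 0) + 0.01 := by
      intro v _
      split_ifs with h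
      · have := pow_le_one₀ (n := (U.filter (fun u => G.Adj v u)).card) hx0 hx1
        linarith
      · push Not at h
        rw [zero_add]
        have hd : dd v = ((U.filter (fun u => G.Adj v u)).card : ℝ) := by
          rw [hdd]; simp only [Finset.sum_boole]
        calc _ ≤ (Real.exp (-(p * ((s:ℝ)/n)))) ^ (U.filter (fun u => G.Adj v u)).card :=
              pow_le_pow_left₀ hx0 (Real.one_sub_le_exp_neg _) _
          _ = Real.exp (-(p * ((s:ℝ)/n) * dd v)) := by
              rw [← Real.exp_nat_mul, hd]; congr 1; ring
          _ ≤ Real.exp (-4.7) := by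
              apply Real.exp_le_exp.2
              apply neg_le_neg
              calc (4.7:ℝ) ≤ 58 * (1/4) * 0.33 := by norm_num
                _ = 58 * (p * b) * 0.33 := by rw [hpb]
                _ = p * 0.33 * (58 * b) := by ring
                _ ≤ _ := by gcongr
          _ ≤ 0.01 := exp_const_small
    refine (Finset.sum_le_sum hterm).trans ?_
    rw [Finset.sum_add_distrib, Finset.sum_boole, Finset.sum_const, nsmul_eq_mul, hUc]
    change (L.card : ℝ) + _ ≤ _
    linarith
  have hms : (m:ℝ) * (1 - (s:ℝ)/n) = m - s / 2 := by
    have : (m:ℝ) = n / 2 := by linarith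
    rw [this]; field_simp
  rw [hms] at hlow
  have hf2n : seedPercExp G p Finset.univ s ≤ n := by
    unfold seedPercExp
    have hc : (0:ℝ) < ((Finset.powersetCard s (Finset.univ : Finset (Fin n))).card : ℝ) := by
      rw [Finset.card_powersetCard, Finset.card_univ, Fintype.card_fin]
      exact_mod_cast Nat.choose_pos hsn
    rw [div_le_iff₀ hc, mul_comm, ← nsmul_eq_mul]
    refine Finset.sum_le_card_nsmul _ _ _ fun S _ => ?_
    rw [percExp_eq]
    calc _ ≤ ∑ v : Fin n, (1:ℝ) := Finset.sum_le_sum fun v _ => xv_le_one G h0 h1 S v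
      _ = n := by simp
  constructor <;> linarith

lemma sbmQ_UU {n : ℕ} {a b : ℝ} (ha : a ≤ n) (hn : 0 < n) (v u : Fin n)
    (hv : v ∈ centralSet n) (hu : u ∈ centralSet n) : sbmQ n a b s(v, u) = a / n := by
  unfold sbmQ
  have hn' : (0:ℝ) < n := by exact_mod_cast hn
  rw [if_pos (by intro i hi; rw [Sym2.mem_iff] at hi; rcases hi with rfl | rfl <;> assumption)]
  exact min_eq_right ((div_le_one hn').2 ha)

lemma sbmQ_W {n : ℕ} {a b : ℝ} (ha : b ≤ n) (hn : 0 < n) (v u : Fin n)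
    (hv : v ∈ (centralSet n)ᶜ) : sbmQ n a b s(v, u) = b / n := by
  unfold sbmQ
  have hn' : (0:ℝ) < n := by exact_mod_cast hn
  rw [if_neg (by
    intro h
    exact (Finset.mem_compl.1 hv) (h v (Sym2.mem_mk_left v u)))]
  exact min_eq_right ((div_le_one hn').2 ha)

lemma sum_ne_le {n : ℕ} (A R : Finset (Fin n)) :
    (∑ v ∈ A, ∑ u ∈ R, if v ≠ u then (1:ℝ) else 0) ≤ A.card * R.card := by
  calc _ ≤ ∑ v ∈ A, ∑ u ∈ R, (1:ℝ) := by
        gcongr with v _ u _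
        split_ifs <;> norm_num
    _ = _ := by simp

lemma sum_ne_ge {n : ℕ} (A R : Finset (Fin n)) :
    (A.card:ℝ) * (R.card - 1) ≤ (∑ v ∈ A, ∑ u ∈ R, if v ≠ u then (1:ℝ) else 0) := by
  rw [← nsmul_eq_mul]
  refine Finset.card_nsmul_le_sum _ _ _ fun v _ => ?_
  rw [Finset.sum_boole]
  have h : R.card ≤ (R.filter (fun u => v ≠ u)).card + 1 := by
    calc R.card ≤ (insert v (R.filter (fun u => v ≠ u))).card := by
          apply Finset.card_le_card
          intro u hu
          by_cases h : v = u <;> simp [h, hu]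
      _ ≤ _ := Finset.card_insert_le _ _
  have : (R.card:ℝ) ≤ (R.filter (fun u => v ≠ u)).card + 1 := by exact_mod_cast h
  linarith

lemma exp_const_up : (Real.exp (2 * 0.01) - 1) / 2 ≤ 0.0102 := by
  have h := Real.exp_bound_div_one_sub_of_interval (x := (0.01:ℝ)) (by norm_num) (by norm_num)
  have h2 : Real.exp (2 * 0.01) = Real.exp 0.01 ^ 2 := by rw [← Real.exp_nat_mul]; norm_num
  have h3 : Real.exp 0.01 ^ 2 ≤ (1 / (1 - 0.01)) ^ 2 :=
    pow_le_pow_left₀ (Real.exp_pos _).le h 2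
  rw [h2]
  norm_num at h3 ⊢
  linarith

lemma exp_const_dn : (Real.exp (2 * (-(1/2:ℝ))) - 1) / 2 ≤ -0.31 := by
  have h1 : (2.7:ℝ) ≤ Real.exp 1 := by linarith [Real.exp_one_gt_d9]
  have h2 : (2 * (-(1/2:ℝ))) = -1 := by norm_num
  rw [h2, Real.exp_neg]
  have : (Real.exp 1)⁻¹ ≤ (2.7:ℝ)⁻¹ := inv_anti₀ (by norm_num) h1
  have h3 : (2.7:ℝ)⁻¹ ≤ 0.38 := by norm_num
  linarith

lemma alg1 (a c x : ℝ) (h : x ≠ 0) : (a / 2 - a / x) * c = a / x * (c * (x / 2 - 1)) := by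
  field_simp

lemma alg2 (b c x : ℝ) (h : x ≠ 0) : b / x * (c * (x / 2)) = b / 2 * c := by
  field_simp

lemma alg3 (b x : ℝ) (h : x ≠ 0) : b / x * (x / 2 * (x / 2)) = b / 4 * x := by
  field_simp
  norm_num

lemma prob_part {n : ℕ} (hn : 1000 ≤ n) (hev : Even n) {a b : ℝ} (hb : 1000000 ≤ b)
    (hab : 200 * b < a) (han : a ≤ n) (P : SimpleGraph (Fin n) → Prop)
    (hP : ∀ G : SimpleGraph (Fin n),
    (∀ A ⊆ centralSet n, 0.001 * (n:ℝ) ≤ A.card → 58 * b * A.card <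
      ∑ v ∈ A, ∑ u ∈ centralSet n, (if G.Adj v u then (1:ℝ) else 0)) →
    (∀ A ⊆ (centralSet n)ᶜ,
      ∑ w ∈ A, ∑ u ∈ (centralSet n)ᶜ, (if G.Adj w u then (1:ℝ) else 0)
      ≤ 0.51 * b * A.card + 0.001 * b * n) →
    (∑ w ∈ (centralSet n)ᶜ, ∑ u ∈ centralSet n, (if G.Adj w u then (1:ℝ) else 0)
      ≤ 0.256 * b * n) → P G) :
    1 - 3 * Real.exp (-(n:ℝ)) ≤ sbmProb n a b P := by
  set U := centralSet n with hU
  set q := sbmQ n a b with hq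
  have hb0 : 0 < b := by linarith
  have ha0 : 0 < a := by linarith
  have hbn : b ≤ n := by linarith
  have hnpos : 0 < n := by omega
  have hn' : (1000:ℝ) ≤ n := by exact_mod_cast hn
  have hn0 : (0:ℝ) < n := by linarith
  obtain ⟨m, hm⟩ := hev
  have hUc : U.card = m := by rw [hU, central_card]; omega
  have hnm : (n:ℝ) = 2 * m := by rw [hm]; push_cast; ring
  have hWc : Uᶜ.card = m := by
    rw [Finset.card_compl, Fintype.card_fin, hUc]; omega
  have h0 : ∀ e, 0 ≤ q e := by
    intro e; rw [hq]; unfold sbmQ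
    split_ifs <;> exact le_min zero_le_one (by positivity)
  have h1 : ∀ e, q e ≤ 1 := by
    intro e; rw [hq]; unfold sbmQ
    split_ifs <;> exact min_le_left _ _
  -- bad events
  have B1 : ∀ A ∈ U.powerset.filter (fun A => 0.001 * (n:ℝ) ≤ A.card),
      cE q (fun f => if -(29 * b * A.card) ≤ (-(1/2:ℝ)) * ∑ v ∈ A, ∑ u ∈ U,
        (if (graphOfConfig f).Adj v u then (1:ℝ) else 0) then 1 else 0) ≤
      Real.exp (-(2 * n)) := by
    intro A hA
    rw [Finset.mem_filter, Finset.mem_powerset] at hA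
    have hc := hA.2
    have hc0 : (0:ℝ) < A.card := by
      have : (0:ℝ) < 0.001 * n := by positivity
      linarith
    refine (chern_deg h0 h1 A U (a/n) (-(1/2)) _ (-(30 * b * A.card)) ?_ ?_).trans ?_
    · intro v hv u hu _
      exact sbmQ_UU han hnpos v u (hA.1 hv) hu
    · have h3 := sum_ne_ge A U
      rw [hUc] at h3
      have h4 := exp_const_dn
      have h5 : (100 * b - 1) * A.card ≤
          a / n * (∑ v ∈ A, ∑ u ∈ U, if v ≠ u then (1:ℝ) else 0) := by
        calc (100 * b - 1) * A.card ≤ (a / 2 - a / n) * A.card := by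
              have : a / n ≤ 1 := (div_le_one hn0).2 han
              gcongr ?_ * _
              linarith
          _ = a / n * (A.card * (m - 1)) := by
              have : (m:ℝ) = n / 2 := by linarith
              rw [this]; exact alg1 _ _ _ hn0.ne'
          _ ≤ _ := by gcongr
      have h6 : 0 ≤ a / n * (∑ v ∈ A, ∑ u ∈ U, if v ≠ u then (1:ℝ) else 0) := by
        refine le_trans ?_ h5
        apply mul_nonneg <;> linarith
      calc _ ≤ a / n * (∑ v ∈ A, ∑ u ∈ U, if v ≠ u then (1:ℝ) else 0) * (-0.31) :=
            mul_le_mul_of_nonneg_left h4 h6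
        _ ≤ (100 * b - 1) * A.card * (-0.31) := by linarith
        _ ≤ _ := by nlinarith
    · apply Real.exp_le_exp.2
      have : 1000000 * (0.001 * (n:ℝ)) ≤ b * A.card := by gcongr
      linarith
  have B2 : ∀ A ∈ Uᶜ.powerset,
      cE q (fun f => if 0.01 * (0.51 * b * A.card + 0.001 * b * n) ≤ 0.01 * ∑ v ∈ A, ∑ u ∈ Uᶜ,
        (if (graphOfConfig f).Adj v u then (1:ℝ) else 0) then 1 else 0) ≤
      Real.exp (-(2 * n)) := by
    intro A hA
    rw [Finset.mem_powerset] at hA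
    refine (chern_deg h0 h1 A Uᶜ (b/n) 0.01 _ (0.01 * (0.51 * b * A.card)) ?_ ?_).trans ?_
    · intro v hv u hu _
      exact sbmQ_W hbn hnpos v u (hA hv)
    · have h3 := sum_ne_le A Uᶜ
      rw [hWc] at h3
      have h5 : b / n * (∑ v ∈ A, ∑ u ∈ Uᶜ, if v ≠ u then (1:ℝ) else 0) ≤ b / 2 * A.card := by
        calc _ ≤ b / n * (A.card * m) := mul_le_mul_of_nonneg_left h3 (by positivity)
          _ = _ := by
              have : (m:ℝ) = n / 2 := by linarith
              rw [this]; exact alg2 _ _ _ hn0.ne'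
      calc _ ≤ b / n * (∑ v ∈ A, ∑ u ∈ Uᶜ, if v ≠ u then (1:ℝ) else 0) * 0.0102 := by
            gcongr
            · exact exp_const_up
        _ ≤ b / 2 * A.card * 0.0102 := by gcongr
        _ = _ := by ring
    · apply Real.exp_le_exp.2
      have : 1000000 * (n:ℝ) ≤ b * n := by gcongr
      linarith
  have B3 : cE q (fun f => if 0.01 * (0.256 * b * n) ≤ 0.01 * ∑ v ∈ Uᶜ, ∑ u ∈ U,
        (if (graphOfConfig f).Adj v u then (1:ℝ) else 0) then 1 else 0) ≤
      Real.exp (-(2 * n)) := by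
    refine (chern_deg h0 h1 Uᶜ U (b/n) 0.01 _ (0.01 * (0.255 * b * n)) ?_ ?_).trans ?_
    · intro v hv u hu _
      exact sbmQ_W hbn hnpos v u hv
    · have h3 := sum_ne_le Uᶜ U
      rw [hWc, hUc] at h3
      have h5 : b / n * (∑ v ∈ Uᶜ, ∑ u ∈ U, if v ≠ u then (1:ℝ) else 0) ≤ b / 4 * n := by
        calc _ ≤ b / n * (m * m) := mul_le_mul_of_nonneg_left h3 (by positivity)
          _ = _ := by
              have : (m:ℝ) = n / 2 := by linarith
              rw [this]; exact alg3 _ _ hn0.ne'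
      calc _ ≤ b / n * (∑ v ∈ Uᶜ, ∑ u ∈ U, if v ≠ u then (1:ℝ) else 0) * 0.0102 := by
            gcongr
            · exact exp_const_up
        _ ≤ b / 4 * n * 0.0102 := by gcongr
        _ = _ := by ring
    · apply Real.exp_le_exp.2
      have : 1000000 * (n:ℝ) ≤ b * n := by gcongr
      linarith
  -- union bound
  set T1 : (Sym2 (Fin n) → Bool) → ℝ := fun f =>
    ∑ A ∈ U.powerset.filter (fun A => 0.001 * (n:ℝ) ≤ A.card),
      (if -(29 * b * A.card) ≤ (-(1/2:ℝ)) * ∑ v ∈ A, ∑ u ∈ U,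
        (if (graphOfConfig f).Adj v u then (1:ℝ) else 0) then (1:ℝ) else 0) with hT1
  set T2 : (Sym2 (Fin n) → Bool) → ℝ := fun f => ∑ A ∈ Uᶜ.powerset,
      (if 0.01 * (0.51 * b * A.card + 0.001 * b * n) ≤ 0.01 * ∑ v ∈ A, ∑ u ∈ Uᶜ,
        (if (graphOfConfig f).Adj v u then (1:ℝ) else 0) then (1:ℝ) else 0) with hT2
  set T3 : (Sym2 (Fin n) → Bool) → ℝ := fun f =>
      (if 0.01 * (0.256 * b * n) ≤ 0.01 * ∑ v ∈ Uᶜ, ∑ u ∈ U,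
        (if (graphOfConfig f).Adj v u then (1:ℝ) else 0) then (1:ℝ) else 0) with hT3
  have hexp : (2:ℝ) ^ n * Real.exp (-(2 * n)) ≤ Real.exp (-n) := by
    have h2 : (2:ℝ) ^ n ≤ Real.exp n := by
      have : (2:ℝ) ≤ Real.exp 1 := by linarith [Real.exp_one_gt_d9]
      calc (2:ℝ) ^ n ≤ Real.exp 1 ^ n := by gcongr
        _ = Real.exp n := by rw [← Real.exp_nat_mul, mul_one]
    calc _ ≤ Real.exp n * Real.exp (-(2 * n)) := by gcongr
      _ = _ := by rw [← Real.exp_add]; congr 1; ring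
  have hpow : ∀ V : Finset (Fin n), (V.powerset.card : ℝ) ≤ 2 ^ n := by
    intro V
    rw [Finset.card_powerset]
    push_cast
    have : V.card ≤ n := by simpa using Finset.card_le_univ V
    gcongr
    norm_num
  have hE1 : cE q T1 ≤ Real.exp (-n) := by
    rw [hT1, cE_sum]
    refine (Finset.sum_le_card_nsmul _ _ _ B1).trans (le_trans ?_ hexp)
    rw [nsmul_eq_mul]
    gcongr
    refine le_trans ?_ (hpow U)
    exact_mod_cast Finset.card_filter_le _ _
  have hE2 : cE q T2 ≤ Real.exp (-n) := by
    rw [hT2, cE_sum]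
    refine (Finset.sum_le_card_nsmul _ _ _ B2).trans (le_trans ?_ hexp)
    rw [nsmul_eq_mul]
    gcongr
    exact hpow Uᶜ
  have hE3 : cE q T3 ≤ Real.exp (-n) := by
    refine B3.trans (Real.exp_le_exp.2 (by linarith))
  have hmain : cE q (fun f => 1 - ((T1 f + T2 f) + T3 f)) ≤ sbmProb n a b P := by
    change _ ≤ cE q (fun f => if P (graphOfConfig f) then (1:ℝ) else 0)
    refine cE_mono h0 h1 fun f => ?_
    have t1 : 0 ≤ T1 f := Finset.sum_nonneg fun A _ => by split_ifs <;> norm_num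
    have t2 : 0 ≤ T2 f := Finset.sum_nonneg fun A _ => by split_ifs <;> norm_num
    have t3 : 0 ≤ T3 f := by simp only [hT3]; split_ifs <;> norm_num
    by_cases hPf : P (graphOfConfig f)
    · simp only [hPf, if_true]; linarith
    · simp only [hPf, if_false]
      by_contra hcon
      push Not at hcon
      apply hPf
      refine hP _ ?_ ?_ ?_
      · intro A hA hc
        by_contra hlt
        push Not at hlt
        have hmem : A ∈ U.powerset.filter (fun A => 0.001 * (n:ℝ) ≤ A.card) := by
          rw [Finset.mem_filter, Finset.mem_powerset]; exact ⟨hA, hc⟩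
        have := Finset.single_le_sum (f := fun A : Finset (Fin n) =>
          (if -(29 * b * A.card) ≤ (-(1/2:ℝ)) * ∑ v ∈ A, ∑ u ∈ U,
            (if (graphOfConfig f).Adj v u then (1:ℝ) else 0) then (1:ℝ) else 0))
          (fun A _ => by split_ifs <;> norm_num) hmem
        rw [if_pos (by linarith)] at this
        change 1 ≤ T1 f at this
        linarith
      · intro A hA
        by_contra hlt
        push Not at hlt
        have := Finset.single_le_sum (f := fun A : Finset (Fin n) =>
          (if 0.01 * (0.51 * b * A.card + 0.001 * b * n) ≤ 0.01 * ∑ v ∈ A, ∑ u ∈ Uᶜ,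
            (if (graphOfConfig f).Adj v u then (1:ℝ) else 0) then (1:ℝ) else 0))
          (fun A _ => by split_ifs <;> norm_num) (Finset.mem_powerset.2 hA)
        rw [if_pos (by linarith)] at this
        change 1 ≤ T2 f at this
        linarith
      · by_contra hlt
        push Not at hlt
        have : T3 f = 1 := by
          simp only [hT3]
          rw [if_pos (by linarith)]
        linarith
  rw [cE_sub, cE_const, cE_add, cE_add] at hmain
  linarith

/-- **Stochastic block model, larger retention probability.** For sufficiently large constants
`a, b` with `a / b > 200`, take retention probability `p = 1 / (4b)` and seed count
`s = n / 3`. Then with high probability as `n → ∞` (over the random graph `G`), central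
seeding infects at most `11/12` times as many nodes in expectation as uniform seeding;
equivalently, the expectation for uniform seeding exceeds that of central seeding by at
least `s / 4 = n / 12`. -/
theorem larger_p_uniform_seeding_sbm :
    ∃ b0 : ℝ, ∀ a b : ℝ, b0 ≤ b → 200 < a / b →
      ∀ ε : ℝ, 0 < ε → ∃ N : ℕ, ∀ n : ℕ, N ≤ n → Even n →
        1 - ε ≤ sbmProb n a b (fun G =>
          seedPercExp G (1 / (4 * b)) (centralSet n) (n / 3)
              ≤ (11 / 12) * seedPercExp G (1 / (4 * b)) Finset.univ (n / 3) ∧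
          ((n / 3 : ℕ) : ℝ) / 4 ≤
            seedPercExp G (1 / (4 * b)) Finset.univ (n / 3)
              - seedPercExp G (1 / (4 * b)) (centralSet n) (n / 3)) := by
  refine ⟨1000000, fun a b hb hab ε hε => ?_⟩
  have hb0 : 0 < b := by linarith
  rw [lt_div_iff₀ hb0] at hab
  obtain ⟨N1, hN1⟩ := exists_nat_ge a
  obtain ⟨N2, hN2⟩ := exists_nat_ge (3 / ε)
  refine ⟨max 1000 (max N1 N2), fun n hn hev => ?_⟩
  have hn1 : 1000 ≤ n := le_trans (le_max_left _ _) hn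
  have hn2 : N1 ≤ n := le_trans (le_trans (le_max_left _ _) (le_max_right _ _)) hn
  have hn3 : N2 ≤ n := le_trans (le_trans (le_max_right _ _) (le_max_right _ _)) hn
  have han : a ≤ n := hN1.trans (by exact_mod_cast hn2)
  have hen : 3 / ε ≤ n := hN2.trans (by exact_mod_cast hn3)
  have hexp : 3 * Real.exp (-(n:ℝ)) ≤ ε := by
    rw [Real.exp_neg]
    have h1 : 3 / ε ≤ Real.exp n := by linarith [Real.add_one_le_exp (n:ℝ)]
    rw [div_le_iff₀ hε] at h1
    rw [← div_eq_mul_inv, div_le_iff₀ (Real.exp_pos _)]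
    linarith
  refine le_trans (by linarith) (prob_part hn1 hev hb hab han _ ?_)
  intro G g1 g2 g3
  exact det_part hn1 hev (by linarith) G g1 g2 g3
end

section
/- Let 0 < γ < 1 and let S ⊆ V with |S| = m. If for every node i ∈ V the row sum over non-seed columns satisfies Σ_{j ∈ V∖S} q_{ij} ≤ γ, then the expected number of vertices in the union of components meeting S satisfies E[|G(S)|] ≤ m/(1 − γ). -/
open scoped Classical
open Finset

/-- Majorant of the number of vertices reached from `u` by paths of length at most `k`
avoiding `A` after the start. -/
noncomputable def explCount {n : ℕ} : ℕ → Finset (Fin n) → Fin n → (Sym2 (Fin n) → Bool) → ℝ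
  | 0, _, _, _ => 1
  | k + 1, A, u, f =>
      1 + ∑ j ∈ Aᶜ, (if f s(u, j) then (1 : ℝ) else 0) * explCount k (insert j A) j f

lemma explCount_nonneg {n : ℕ} (k : ℕ) : ∀ (A : Finset (Fin n)) (u : Fin n)
    (f : Sym2 (Fin n) → Bool), 0 ≤ explCount k A u f := by
  induction k with
  | zero => intro A u f; simp [explCount]
  | succ k ih =>
    intro A u f
    simp only [explCount]
    refine add_nonneg zero_le_one (Finset.sum_nonneg fun j _ => mul_nonneg ?_ (ih _ _ _))
    split_ifs <;> norm_num

lemma explCount_congr {n : ℕ} (w : Fin n) (f g : Sym2 (Fin n) → Bool)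
    (hfg : ∀ e, w ∉ e → f e = g e) (k : ℕ) : ∀ (A : Finset (Fin n)) (u : Fin n),
    w ∈ A → w ≠ u → explCount k A u f = explCount k A u g := by
  induction k with
  | zero => intro A u _ _; simp [explCount]
  | succ k ih =>
    intro A u hw hu
    simp only [explCount]
    congr 1
    refine Finset.sum_congr rfl fun j hj => ?_
    have hj' : w ≠ j := by
      rintro rfl
      exact (Finset.mem_compl.mp hj) hw
    rw [ih (insert j A) j (Finset.mem_insert_of_mem hw) hj', hfg s(u, j) (by simp [hu, hj'])]

lemma configWeight_split {n : ℕ} (q : Sym2 (Fin n) → ℝ) (f : Sym2 (Fin n) → Bool)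
    (e : Sym2 (Fin n)) : configWeight q f =
      (if f e then q e else 1 - q e) *
        ∏ e' ∈ Finset.univ.erase e, (if f e' then q e' else 1 - q e') := by
  unfold configWeight
  exact (Finset.mul_prod_erase Finset.univ (fun e => if f e then q e else 1 - q e)
    (Finset.mem_univ e)).symm

lemma configWeight_sum {n : ℕ} (q : Sym2 (Fin n) → ℝ) :
    ∑ f : Sym2 (Fin n) → Bool, configWeight q f = 1 := by
  unfold configWeight
  have h := Finset.prod_univ_sum (fun _ : Sym2 (Fin n) => (Finset.univ : Finset Bool))
    (fun e b => if b then q e else 1 - q e)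
  rw [Fintype.piFinset_univ] at h
  rw [← h]
  simp

lemma configWeight_nonneg {n : ℕ} (q : Sym2 (Fin n) → ℝ) (h0 : ∀ e, 0 ≤ q e)
    (h1 : ∀ e, q e ≤ 1) (f : Sym2 (Fin n) → Bool) : 0 ≤ configWeight q f := by
  unfold configWeight
  refine Finset.prod_nonneg fun e _ => ?_
  split_ifs
  · exact h0 e
  · linarith [h1 e]

lemma configWeight_indep {n : ℕ} (q : Sym2 (Fin n) → ℝ) (e : Sym2 (Fin n))
    (X : (Sym2 (Fin n) → Bool) → ℝ)
    (hX : ∀ f b, X (Function.update f e b) = X f) :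
    ∑ f, configWeight q f * ((if f e then (1 : ℝ) else 0) * X f)
      = q e * ∑ f, configWeight q f * X f := by
  rw [← sub_eq_zero, Finset.mul_sum, ← Finset.sum_sub_distrib]
  refine Finset.sum_involution (fun f _ => Function.update f e (!f e)) ?_ ?_ ?_ ?_
  · intro f _
    rw [configWeight_split q f e, configWeight_split q (Function.update f e (!f e)) e, hX]
    have hp : ∏ e' ∈ Finset.univ.erase e,
        (if Function.update f e (!f e) e' then q e' else 1 - q e')
        = ∏ e' ∈ Finset.univ.erase e, (if f e' then q e' else 1 - q e') := by
      refine Finset.prod_congr rfl fun e' he' => ?_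
      rw [Function.update_of_ne (Finset.ne_of_mem_erase he')]
    rw [hp]
    cases hfe : f e <;> simp <;> ring
  · intro f _ _ h
    have := congrFun h e
    simp at this
  · intro f _; exact Finset.mem_univ _
  · intro f _; simp

lemma explCount_exp {n : ℕ} (Q : Fin n → Fin n → ℝ)
    (hsym : ∀ i j, Q i j = Q j i) (h0 : ∀ i j, 0 ≤ Q i j)
    (S : Finset (Fin n)) (γ : ℝ) (hγ0 : 0 < γ) (hγ1 : γ < 1)
    (hrow : ∀ i : Fin n, ∑ j ∈ Sᶜ, Q i j ≤ γ) (k : ℕ) :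
    ∀ (A : Finset (Fin n)) (u : Fin n), S ⊆ A → u ∈ A →
      ∑ f, configWeight (Sym2.lift ⟨Q, hsym⟩) f * explCount k A u f ≤ 1 / (1 - γ) := by
  have hpos : 0 < 1 - γ := by linarith
  induction k with
  | zero =>
    intro A u _ _
    simp only [explCount, mul_one, configWeight_sum]
    rw [le_div_iff₀ hpos]; linarith
  | succ k ih =>
    intro A u hS hu
    simp only [explCount, mul_add, mul_one, Finset.sum_add_distrib, configWeight_sum,
      Finset.mul_sum]
    rw [Finset.sum_comm]
    have hterm : ∀ j ∈ Aᶜ, ∑ f, configWeight (Sym2.lift ⟨Q, hsym⟩) f *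
        ((if f s(u, j) then (1 : ℝ) else 0) * explCount k (insert j A) j f)
        ≤ Q u j * (1 / (1 - γ)) := by
      intro j hj
      have huj : u ≠ j := by
        rintro rfl
        exact (Finset.mem_compl.mp hj) hu
      rw [configWeight_indep]
      · exact mul_le_mul_of_nonneg_left
          (ih _ _ (hS.trans (Finset.subset_insert _ _)) (Finset.mem_insert_self _ _)) (h0 u j)
      · intro f b
        refine explCount_congr u _ _ ?_ k _ _ (Finset.mem_insert_of_mem hu) huj
        intro e he
        rw [Function.update_of_ne]
        rintro rfl
        simp at he
    have h2 : ∑ j ∈ Aᶜ, Q u j ≤ γ :=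
      (Finset.sum_le_sum_of_subset_of_nonneg (Finset.compl_subset_compl.mpr hS)
        (fun j _ _ => h0 u j)).trans (hrow u)
    have h3 := Finset.sum_le_sum hterm
    rw [← Finset.sum_mul] at h3
    have h4 : (∑ j ∈ Aᶜ, Q u j) * (1 / (1 - γ)) ≤ γ * (1 / (1 - γ)) :=
      mul_le_mul_of_nonneg_right h2 (by positivity)
    have h5 : 1 + γ * (1 / (1 - γ)) = 1 / (1 - γ) := by field_simp; ring
    linarith

/-- Vertices reached from `u` by paths of length at most `k` avoiding `A` after the start. -/
def explSet {n : ℕ} (G : SimpleGraph (Fin n)) (k : ℕ) (A : Finset (Fin n)) (u : Fin n) :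
    Set (Fin n) :=
  {v | ∃ p : G.Walk u v, p.IsPath ∧ p.length ≤ k ∧ ∀ x ∈ p.support.tail, x ∉ A}

lemma graphOfConfig_adj {n : ℕ} {f : Sym2 (Fin n) → Bool} {u v : Fin n}
    (h : (graphOfConfig f).Adj u v) : f s(u, v) = true := by
  simp only [graphOfConfig, SimpleGraph.fromRel_adj] at h
  rcases h.2 with h | h
  · exact h
  · rwa [Sym2.eq_swap]

lemma explSet_card {n : ℕ} (f : Sym2 (Fin n) → Bool) (k : ℕ) :
    ∀ (A : Finset (Fin n)) (u : Fin n),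
      ((explSet (graphOfConfig f) k A u).ncard : ℝ) ≤ explCount k A u f := by
  induction k with
  | zero =>
    intro A u
    have : explSet (graphOfConfig f) 0 A u ⊆ {u} := by
      rintro v ⟨p, _, hl, _⟩
      cases p with
      | nil => rfl
      | cons h p => simp at hl
    have h := Set.ncard_le_ncard this
    rw [Set.ncard_singleton] at h
    simp only [explCount]
    exact_mod_cast h
  | succ k ih =>
    intro A u
    have hsub : explSet (graphOfConfig f) (k + 1) A u ⊆
        {u} ∪ ⋃ j ∈ Aᶜ.filter (fun j => f s(u, j) = true),
          explSet (graphOfConfig f) k (insert j A) j := by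
      rintro v ⟨p, hp, hl, hA⟩
      cases p with
      | nil => left; rfl
      | @cons _ j _ h p =>
        right
        rw [SimpleGraph.Walk.cons_isPath_iff] at hp
        simp only [SimpleGraph.Walk.support_cons, List.tail_cons] at hA
        simp only [SimpleGraph.Walk.length_cons] at hl
        simp only [Set.mem_iUnion]
        refine ⟨j, ?_, p, hp.1, by omega, ?_⟩
        · simp only [Finset.mem_filter, Finset.mem_compl]
          exact ⟨hA j p.start_mem_support, graphOfConfig_adj h⟩
        · intro x hx hx'
          rcases Finset.mem_insert.mp hx' with rfl | hx'
          · have := hp.1.support_nodup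
            rw [SimpleGraph.Walk.support_eq_cons] at this
            exact (List.nodup_cons.mp this).1 hx
          · exact hA x (List.mem_of_mem_tail hx) hx'
    have h1 := (Set.ncard_le_ncard hsub).trans (Set.ncard_union_le _ _)
    have h2 := Finset.set_ncard_biUnion_le (Aᶜ.filter (fun j => f s(u, j) = true))
      (fun j => explSet (graphOfConfig f) k (insert j A) j)
    rw [Set.ncard_singleton] at h1
    have h3 := h1.trans (Nat.add_le_add_left h2 1)
    have h4 : ((explSet (graphOfConfig f) (k + 1) A u).ncard : ℝ) ≤
      1 + ∑ j ∈ Aᶜ.filter (fun j => f s(u, j) = true),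
        ((explSet (graphOfConfig f) k (insert j A) j).ncard : ℝ) := by exact_mod_cast h3
    refine h4.trans ?_
    simp only [explCount, ite_mul, one_mul, zero_mul]
    rw [← Finset.sum_filter]
    gcongr with j hj
    exact ih _ _

lemma exists_last_seed {n : ℕ} (G : SimpleGraph (Fin n)) (S : Finset (Fin n)) {a v : Fin n}
    (p : G.Walk a v) :
    (∃ p' : G.Walk a v, p'.IsPath ∧ ∀ x ∈ p'.support, x ∉ S) ∨
    (∃ u ∈ S, ∃ p' : G.Walk u v, p'.IsPath ∧ ∀ x ∈ p'.support.tail, x ∉ S) := by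
  induction p with
  | @nil a =>
    by_cases h : a ∈ S
    · right; exact ⟨a, h, .nil, by simp, by simp⟩
    · left; exact ⟨.nil, by simp, by simpa using h⟩
  | @cons a b v h p ih =>
    rcases ih with ⟨p', hp', hS⟩ | h2
    · have hsub : ∀ x ∈ (SimpleGraph.Walk.cons h p').bypass.support, x = a ∨ x ∈ p'.support := by
        intro x hx
        have := SimpleGraph.Walk.support_bypass_subset _ hx
        simpa using this
      have hpath := SimpleGraph.Walk.bypass_isPath (SimpleGraph.Walk.cons h p')
      by_cases ha : a ∈ S
      · right
        refine ⟨a, ha, _, hpath, ?_⟩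
        intro x hx
        rcases hsub x (List.mem_of_mem_tail hx) with rfl | hx'
        · have := hpath.support_nodup
          rw [SimpleGraph.Walk.support_eq_cons] at this
          exact absurd hx (List.nodup_cons.mp this).1
        · exact hS x hx'
      · left
        refine ⟨_, hpath, ?_⟩
        intro x hx
        rcases hsub x hx with rfl | hx'
        · exact ha
        · exact hS x hx'
    · right; exact h2

lemma clusterSize_le {n : ℕ} (f : Sym2 (Fin n) → Bool) (S : Finset (Fin n)) :
    (clusterSize (graphOfConfig f) S : ℝ) ≤ ∑ u ∈ S, explCount n S u f := by
  have hsub : {v : Fin n | ∃ u ∈ S, (graphOfConfig f).Reachable u v} ⊆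
      ⋃ u ∈ S, explSet (graphOfConfig f) n S u := by
    rintro v ⟨a, ha, ⟨p⟩⟩
    simp only [Set.mem_iUnion]
    rcases exists_last_seed _ S p with ⟨p', _, h⟩ | ⟨u, hu, p', hp', h⟩
    · exact absurd ha (h a p'.start_mem_support)
    · refine ⟨u, hu, p', hp', ?_, h⟩
      have := hp'.length_lt
      simp at this
      exact this.le
  have h1 := (Set.ncard_le_ncard hsub).trans (Finset.set_ncard_biUnion_le S _)
  have h2 : (clusterSize (graphOfConfig f) S : ℝ) ≤
      ∑ u ∈ S, ((explSet (graphOfConfig f) n S u).ncard : ℝ) := by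
    unfold clusterSize
    exact_mod_cast h1
  exact h2.trans (Finset.sum_le_sum fun u _ => explSet_card f n S u)

/-- **Upper bound on the expected infected cluster size** (Lemma 1(a) of the SI).
If every row sum of the edge-probability matrix `Q` over the non-seed columns is at most
`γ < 1`, then the expected number of vertices in the union of components meeting the seed
set `S` (of size `m = |S|`) is at most `m / (1 - γ)`. -/
theorem irg_cluster_upper_bound {n : ℕ} (Q : Fin n → Fin n → ℝ)
    (hsym : ∀ i j, Q i j = Q j i) (h0 : ∀ i j, 0 ≤ Q i j) (h1 : ∀ i j, Q i j ≤ 1)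
    (S : Finset (Fin n)) (γ : ℝ) (hγ0 : 0 < γ) (hγ1 : γ < 1)
    (hrow : ∀ i : Fin n, ∑ j ∈ Sᶜ, Q i j ≤ γ) :
    irgExp (Sym2.lift ⟨Q, hsym⟩) (fun G => (clusterSize G S : ℝ)) ≤ (S.card : ℝ) / (1 - γ) := by
  have hw : ∀ f, 0 ≤ configWeight (Sym2.lift ⟨Q, hsym⟩) f := by
    refine configWeight_nonneg _ ?_ ?_
    · intro e
      induction e using Sym2.ind with
      | _ x y => exact h0 x y
    · intro e
      induction e using Sym2.ind with
      | _ x y => exact h1 x y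
  unfold irgExp
  calc ∑ f, configWeight (Sym2.lift ⟨Q, hsym⟩) f * (clusterSize (graphOfConfig f) S : ℝ)
      ≤ ∑ f, configWeight (Sym2.lift ⟨Q, hsym⟩) f * ∑ u ∈ S, explCount n S u f :=
        Finset.sum_le_sum fun f _ => mul_le_mul_of_nonneg_left (clusterSize_le f S) (hw f)
    _ = ∑ u ∈ S, ∑ f, configWeight (Sym2.lift ⟨Q, hsym⟩) f * explCount n S u f := by
        simp only [Finset.mul_sum]
        rw [Finset.sum_comm]
    _ ≤ ∑ u ∈ S, 1 / (1 - γ) := Finset.sum_le_sum fun u hu =>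
        explCount_exp Q hsym h0 S γ hγ0 hγ1 hrow n S u (Finset.Subset.refl S) hu
    _ = (S.card : ℝ) / (1 - γ) := by
        rw [Finset.sum_const, nsmul_eq_mul, mul_one_div]
end

section
/- Let 0 < γ < 1 and let S ⊆ V with |S| = m. If q_{ij} = γ/n for every pair of distinct nodes i ≠ j with i ∈ V∖S, then the expected number of vertices in the union of components meeting S satisfies E[|G(S)|] ≥ m·(n + γn)/(n + γm). -/
open scoped Classical
open Finset

theorem irg_sum_weight {n : ℕ} (g : Sym2 (Fin n) → Bool → ℝ) :
    ∑ f : Sym2 (Fin n) → Bool, ∏ e, g e (f e) = ∏ e, (g e true + g e false) := by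
  have := Finset.prod_univ_sum (fun _ : Sym2 (Fin n) => (Finset.univ : Finset Bool)) g
  rw [Fintype.piFinset_univ] at this
  simpa using this.symm

theorem irg_total {n : ℕ} (q : Sym2 (Fin n) → ℝ) : ∑ f, configWeight q f = 1 := by
  unfold configWeight
  rw [irg_sum_weight (fun e b => if b then q e else 1 - q e)]
  simp

theorem irg_none {n : ℕ} (q : Sym2 (Fin n) → ℝ) (T : Finset (Sym2 (Fin n))) :
    ∑ f, configWeight q f * (if ∀ e ∈ T, f e = false then 1 else 0) = ∏ e ∈ T, (1 - q e) := by
  have h : ∀ f : Sym2 (Fin n) → Bool,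
      configWeight q f * (if ∀ e ∈ T, f e = false then 1 else 0)
        = ∏ e, (if f e then (if e ∈ T then 0 else q e) else 1 - q e) := by
    intro f
    unfold configWeight
    split_ifs with hT
    · rw [mul_one]
      refine Finset.prod_congr rfl fun e _ => ?_
      by_cases he : e ∈ T
      · simp [hT e he]
      · simp [he]
    · push Not at hT
      obtain ⟨e, he, hf⟩ := hT
      rw [mul_zero]
      symm
      apply Finset.prod_eq_zero (Finset.mem_univ e)
      simp [he, hf]
  rw [Finset.sum_congr rfl fun f _ => h f,
    irg_sum_weight (fun e b => if b then (if e ∈ T then 0 else q e) else 1 - q e)]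
  rw [← Finset.prod_subset (Finset.subset_univ T)]
  · refine Finset.prod_congr rfl fun e he => ?_
    simp [he]
  · intro e _ he
    simp [he]

theorem irg_cluster_ge {n : ℕ} (f : Sym2 (Fin n) → Bool) (S : Finset (Fin n)) :
    (S.card : ℝ) + ∑ v ∈ Sᶜ, (1 - (if ∀ e ∈ S.image (fun u => s(u, v)), f e = false
      then (1 : ℝ) else 0)) ≤ (clusterSize (graphOfConfig f) S : ℝ) := by
  have hc : (clusterSize (graphOfConfig f) S : ℝ)
      = ∑ v, (if ∃ u ∈ S, (graphOfConfig f).Reachable u v then (1 : ℝ) else 0) := by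
    unfold clusterSize
    rw [Set.ncard_eq_toFinset_card', Finset.sum_boole]
    congr 2
    ext v
    simp
  rw [hc, ← Finset.sum_add_sum_compl S]
  apply add_le_add
  · rw [Finset.card_eq_sum_ones, Nat.cast_sum]
    refine Finset.sum_le_sum fun v hv => ?_
    rw [if_pos ⟨v, hv, SimpleGraph.Reachable.refl _⟩]
    simp
  · refine Finset.sum_le_sum fun v hv => ?_
    by_cases hT : ∀ e ∈ S.image (fun u => s(u, v)), f e = false
    · rw [if_pos hT]
      split_ifs <;> norm_num
    · rw [if_neg hT]
      push Not at hT
      obtain ⟨e, he, hf⟩ := hT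
      obtain ⟨u, hu, rfl⟩ := Finset.mem_image.1 he
      rw [if_pos]
      · norm_num
      · refine ⟨u, hu, SimpleGraph.Adj.reachable ?_⟩
        unfold graphOfConfig
        rw [SimpleGraph.fromRel_adj]
        refine ⟨?_, Or.inl (by simpa using hf)⟩
        rintro rfl
        exact (Finset.mem_compl.1 hv) hu

theorem irg_arith (p : ℝ) (hp0 : 0 ≤ p) (hp1 : p ≤ 1) (m : ℕ) :
    (1 - p) ^ m * (1 + p * m) ≤ 1 := by
  have h1 : 1 + p * m ≤ (1 + p) ^ m := by
    have := one_add_mul_le_pow (show (-2 : ℝ) ≤ p by linarith) m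
    linarith
  calc (1 - p) ^ m * (1 + p * m) ≤ (1 - p) ^ m * (1 + p) ^ m :=
        mul_le_mul_of_nonneg_left h1 (pow_nonneg (by linarith) m)
    _ = (1 - p ^ 2) ^ m := by rw [← mul_pow]; ring
    _ ≤ 1 := pow_le_one₀ (by nlinarith) (by nlinarith)

/-- **Lower bound on the expected infected cluster size** (Lemma 1(b) of the SI).
If `q_{ij} = γ / n` for every pair of distinct nodes `i ≠ j` with `i ∉ S`, then the expected
number of vertices in the union of components meeting the seed set `S` (of size `m = |S|`)
is at least `m (n + γ n) / (n + γ m)`. -/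
theorem irg_cluster_lower_bound {n : ℕ} (hn : 1 ≤ n) (Q : Fin n → Fin n → ℝ)
    (hsym : ∀ i j, Q i j = Q j i) (h0 : ∀ i j, 0 ≤ Q i j) (h1 : ∀ i j, Q i j ≤ 1)
    (S : Finset (Fin n)) (γ : ℝ) (hγ0 : 0 < γ) (hγ1 : γ < 1)
    (hcross : ∀ i j : Fin n, i ≠ j → i ∉ S → Q i j = γ / n) :
    (S.card : ℝ) * ((n : ℝ) + γ * n) / ((n : ℝ) + γ * S.card) ≤
      irgExp (Sym2.lift ⟨Q, hsym⟩) (fun G => (clusterSize G S : ℝ)) := by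
  set q := Sym2.lift ⟨Q, hsym⟩ with hq
  have hq0 : ∀ e, 0 ≤ q e := fun e => by
    induction e with | _ i j => simpa [hq] using h0 i j
  have hq1 : ∀ e, q e ≤ 1 := fun e => by
    induction e with | _ i j => simpa [hq] using h1 i j
  have hn' : (1 : ℝ) ≤ n := by exact_mod_cast hn
  have hw : ∀ f, 0 ≤ configWeight q f := fun f => by
    refine Finset.prod_nonneg fun e _ => ?_
    split_ifs
    · exact hq0 e
    · linarith [hq1 e]
  have key : (S.card : ℝ) + (n - S.card) * (1 - (1 - γ / n) ^ S.card) ≤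
      irgExp q (fun G => (clusterSize G S : ℝ)) := by
    unfold irgExp
    refine le_trans (le_of_eq ?_) (Finset.sum_le_sum fun f _ =>
      mul_le_mul_of_nonneg_left (irg_cluster_ge f S) (hw f))
    simp only [mul_add, Finset.mul_sum, Finset.sum_add_distrib]
    rw [← Finset.sum_mul, irg_total, one_mul, Finset.sum_comm]
    congr 1
    have hv : ∀ v ∈ Sᶜ, ∑ f, configWeight q f * (1 - (if ∀ e ∈ S.image (fun u => s(u, v)),
        f e = false then (1 : ℝ) else 0)) = 1 - (1 - γ / n) ^ S.card := by
      intro v hv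
      have hvS : v ∉ S := Finset.mem_compl.1 hv
      simp only [mul_sub, mul_one, Finset.sum_sub_distrib]
      rw [irg_total, irg_none, Finset.prod_image]
      · congr 1
        rw [← Finset.prod_const]
        refine Finset.prod_congr rfl fun u hu => ?_
        have hne : v ≠ u := fun h => hvS (h ▸ hu)
        rw [← hcross v u hne hvS, hsym v u, hq]
        simp
      · intro a _ b _ hab
        have h2 : a = b ∨ a = v ∧ v = b := by simpa using hab
        rcases h2 with h | ⟨h, h'⟩
        · exact h
        · exact h.trans h'
    rw [Finset.sum_congr rfl hv, Finset.sum_const, nsmul_eq_mul, Finset.card_compl,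
      Fintype.card_fin, Nat.cast_sub (by simpa using Finset.card_le_univ S)]
  refine le_trans ?_ key
  have hm : (S.card : ℝ) ≤ n := by exact_mod_cast (by simpa using Finset.card_le_univ S)
  have hp0 : 0 ≤ γ / n := by positivity
  have hp1 : γ / n ≤ 1 := by rw [div_le_one (by linarith)]; linarith
  have ha := irg_arith (γ / n) hp0 hp1 S.card
  have hγ : γ = γ / n * n := by field_simp
  generalize γ / n = p at *
  have hD : 0 < (n : ℝ) + γ * S.card := by positivity
  rw [div_le_iff₀ hD]
  generalize (1 - p) ^ S.card = x at *
  subst hγ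
  have := mul_nonneg (mul_nonneg (sub_nonneg.2 hm) (sub_nonneg.2 ha)) (by linarith : (0 : ℝ) ≤ n)
  linarith
end

section
/- For very small retention probability, the seed set with more boundary edges is more dangerous: let G be a fixed finite simple graph and let S, S′ ⊆ V with |S| = |S′| and e(S, V∖S) > e(S′, V∖S′). Then there exists p0 > 0 such that for all p ∈ (0, p0), E_p[|G^p(S)|] > E_p[|G^p(S′)|]. -/
open scoped Classical
open Finset

/-- `e(S, V∖S)`: the number of edges of `G` with exactly one endpoint in `S`. -/
noncomputable def boundaryEdgeCount {n : ℕ} (G : SimpleGraph (Fin n)) (S : Finset (Fin n)) : ℕ :=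
  Set.ncard {e : Sym2 (Fin n) | e ∈ G.edgeSet ∧ ∃ u v : Fin n, e = s(u, v) ∧ u ∈ S ∧ v ∉ S}


theorem clusterSize_eq_of_closed {n : ℕ} (H : SimpleGraph (Fin n)) (S T : Finset (Fin n))
    (hST : S ⊆ T) (hc : ∀ u ∈ T, ∀ v, H.Adj u v → v ∈ T)
    (hr : ∀ v ∈ T, ∃ u ∈ S, H.Reachable u v) : clusterSize H S = T.card := by
  unfold clusterSize
  rw [← Set.ncard_coe_finset]
  congr 1
  ext v
  constructor
  · rintro ⟨u, hu, huv⟩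
    rw [SimpleGraph.reachable_iff_reflTransGen] at huv
    induction huv with
    | refl => exact hST hu
    | tail _ h ih => exact hc _ ih _ h
  · intro hv
    exact hr v hv

/-- Configuration with a single present edge. -/
noncomputable def singleCfg {n : ℕ} (e : Sym2 (Fin n)) : Sym2 (Fin n) → Bool :=
  fun x => decide (x = e)

theorem singleCfg_adj {n : ℕ} (a b u v : Fin n) (hab : a ≠ b) :
    (graphOfConfig (singleCfg s(a, b))).Adj u v ↔ (u = a ∧ v = b) ∨ (u = b ∧ v = a) := by
  simp only [graphOfConfig, singleCfg, SimpleGraph.fromRel_adj, decide_eq_true_eq, Sym2.eq_iff]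
  constructor
  · rintro ⟨_, h | h⟩ <;> tauto
  · rintro (⟨rfl, rfl⟩ | ⟨rfl, rfl⟩)
    · exact ⟨hab, by simp⟩
    · exact ⟨hab.symm, by simp⟩

theorem clusterSize_single_aux {n : ℕ} (S : Finset (Fin n)) (a b : Fin n) (ha : a ∈ S)
    (hb : b ∉ S) :
    clusterSize (graphOfConfig (singleCfg s(a, b))) S = S.card + 1 := by
  have hab : a ≠ b := fun h => hb (h ▸ ha)
  rw [clusterSize_eq_of_closed _ S (insert b S) (Finset.subset_insert _ _),
    Finset.card_insert_of_notMem hb]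
  · intro u _ v h
    rw [singleCfg_adj a b u v hab] at h
    rcases h with ⟨_, rfl⟩ | ⟨_, rfl⟩
    · simp
    · simp [ha]
  · intro v hv
    rcases Finset.mem_insert.1 hv with rfl | hv
    · exact ⟨a, ha, SimpleGraph.Adj.reachable ((singleCfg_adj a v a v hab).2 (by simp))⟩
    · exact ⟨v, hv, SimpleGraph.Reachable.refl _⟩

theorem clusterSize_single {n : ℕ} (G : SimpleGraph (Fin n)) (S : Finset (Fin n))
    (e : Sym2 (Fin n)) (he : e ∈ G.edgeSet) :
    clusterSize (graphOfConfig (singleCfg e)) S = S.card +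
      if e ∈ {e : Sym2 (Fin n) | e ∈ G.edgeSet ∧ ∃ u v : Fin n, e = s(u, v) ∧ u ∈ S ∧ v ∉ S}
      then 1 else 0 := by
  split_ifs with h
  · obtain ⟨_, u, v, rfl, hu, hv⟩ := h
    exact clusterSize_single_aux S u v hu hv
  · induction e using Sym2.ind with
    | _ a b =>
    have hab : a ≠ b := G.ne_of_adj he
    have h1 : ¬ (a ∈ S ∧ b ∉ S) := fun hh => h ⟨he, a, b, rfl, hh⟩
    have h2 : ¬ (b ∈ S ∧ a ∉ S) := fun hh => h ⟨he, b, a, Sym2.eq_swap, hh⟩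
    rw [clusterSize_eq_of_closed _ S S (Finset.Subset.refl _), add_zero]
    · intro u hu v hv
      rw [singleCfg_adj a b u v hab] at hv
      rcases hv with ⟨rfl, rfl⟩ | ⟨rfl, rfl⟩ <;> tauto
    · intro v hv
      exact ⟨v, hv, SimpleGraph.Reachable.refl _⟩

theorem clusterSize_empty {n : ℕ} (S : Finset (Fin n)) (f : Sym2 (Fin n) → Bool)
    (hf : ∀ e, f e = false) : clusterSize (graphOfConfig f) S = S.card := by
  apply clusterSize_eq_of_closed _ S S (Finset.Subset.refl _)
  · intro u _ v h
    simp [graphOfConfig, hf] at h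
  · intro v hv
    exact ⟨v, hv, SimpleGraph.Reachable.refl _⟩

theorem clusterSize_le_s8 {n : ℕ} (H : SimpleGraph (Fin n)) (S : Finset (Fin n)) :
    clusterSize H S ≤ n := by
  unfold clusterSize
  refine (Set.ncard_le_ncard (Set.subset_univ _) (Set.toFinite _)).trans ?_
  simp [Set.ncard_univ]

theorem sum_clusterSize_single {n : ℕ} (G : SimpleGraph (Fin n)) (S : Finset (Fin n)) :
    ∑ e ∈ univ.filter (fun e => e ∈ G.edgeSet),
      (clusterSize (graphOfConfig (singleCfg e)) S : ℝ) =
    ((univ.filter (fun e => e ∈ G.edgeSet)).card : ℝ) * S.card + boundaryEdgeCount G S := by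
  have h1 : ∀ e ∈ univ.filter (fun e => e ∈ G.edgeSet),
      (clusterSize (graphOfConfig (singleCfg e)) S : ℝ) = (S.card : ℝ) +
      if e ∈ {e : Sym2 (Fin n) | e ∈ G.edgeSet ∧ ∃ u v : Fin n, e = s(u, v) ∧ u ∈ S ∧ v ∉ S}
      then 1 else 0 := by
    intro e he
    rw [clusterSize_single G S e (Finset.mem_filter.1 he).2]
    push_cast
    rfl
  rw [Finset.sum_congr rfl h1, Finset.sum_add_distrib, Finset.sum_const, nsmul_eq_mul,
    Finset.sum_boole]
  congr 2
  unfold boundaryEdgeCount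
  rw [← Set.ncard_coe_finset]
  congr 1
  ext e
  simp

/-- Edge probabilities of percolation. -/
noncomputable def percQ {n : ℕ} (G : SimpleGraph (Fin n)) (p : ℝ) : Sym2 (Fin n) → ℝ :=
  fun e => if e ∈ G.edgeSet then p else 0

theorem weight_factor_bounds {n : ℕ} (G : SimpleGraph (Fin n)) (p : ℝ) (h0 : 0 ≤ p)
    (h1 : p ≤ 1) (f : Sym2 (Fin n) → Bool) (e : Sym2 (Fin n)) :
    0 ≤ (if f e then percQ G p e else 1 - percQ G p e) ∧
    (if f e then percQ G p e else 1 - percQ G p e) ≤ 1 := by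
  unfold percQ
  split_ifs <;> constructor <;> linarith

theorem weight_single {n : ℕ} (G : SimpleGraph (Fin n)) (p : ℝ)
    (e : Sym2 (Fin n)) (he : e ∈ G.edgeSet) :
    configWeight (percQ G p) (singleCfg e) =
      p * (1 - p) ^ ((univ.filter (fun e => e ∈ G.edgeSet)).card - 1) := by
  unfold configWeight
  rw [← Finset.mul_prod_erase univ _ (Finset.mem_univ e)]
  have h2 : ∀ x ∈ univ.erase e, (if singleCfg e x then percQ G p x else 1 - percQ G p x) =
      if x ∈ G.edgeSet then (1 - p) else 1 := by
    intro x hx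
    have : x ≠ e := Finset.ne_of_mem_erase hx
    simp only [singleCfg, this, decide_false, percQ]
    split_ifs <;> simp_all
  rw [Finset.prod_congr rfl h2, ← Finset.prod_filter, Finset.prod_const, Finset.filter_erase,
    Finset.card_erase_of_mem (by simp [he])]
  simp [singleCfg, percQ, he]

theorem weight_two {n : ℕ} (G : SimpleGraph (Fin n)) (p : ℝ) (h0 : 0 ≤ p)
    (h1 : p ≤ 1) (f : Sym2 (Fin n) → Bool) (e e' : Sym2 (Fin n)) (hne : e' ≠ e)
    (hfe : f e) (hfe' : f e') :
    0 ≤ configWeight (percQ G p) f ∧ configWeight (percQ G p) f ≤ p ^ 2 := by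
  have hb := weight_factor_bounds G p h0 h1 f
  unfold configWeight
  refine ⟨Finset.prod_nonneg fun x _ => (hb x).1, ?_⟩
  rw [← Finset.mul_prod_erase univ _ (Finset.mem_univ e),
    ← Finset.mul_prod_erase (univ.erase e) _ (Finset.mem_erase.2 ⟨hne, Finset.mem_univ e'⟩)]
  have hr : ∏ x ∈ (univ.erase e).erase e',
      (if f x then percQ G p x else 1 - percQ G p x) ≤ 1 :=
    Finset.prod_le_one (fun x _ => (hb x).1) (fun x _ => (hb x).2)
  have hr0 : 0 ≤ ∏ x ∈ (univ.erase e).erase e',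
      (if f x then percQ G p x else 1 - percQ G p x) :=
    Finset.prod_nonneg (fun x _ => (hb x).1)
  have hq : ∀ x, 0 ≤ percQ G p x ∧ percQ G p x ≤ p := by
    intro x
    unfold percQ
    split_ifs <;> constructor <;> linarith
  simp only [hfe, hfe', if_true]
  rw [← mul_assoc]
  calc _ ≤ percQ G p e * percQ G p e' * 1 :=
        mul_le_mul_of_nonneg_left hr (mul_nonneg (hq e).1 (hq e').1)
    _ ≤ p ^ 2 := by
        rw [mul_one, sq]
        exact mul_le_mul (hq e).2 (hq e').2 (hq e').1 h0

theorem singleCfg_injective {n : ℕ} : Function.Injective (singleCfg (n := n)) := by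
  intro a b h
  have := congrFun h a
  simpa [singleCfg] using this

theorem weight_not_mem {n : ℕ} (G : SimpleGraph (Fin n)) (p : ℝ)
    (f : Sym2 (Fin n) → Bool) (e : Sym2 (Fin n)) (hfe : f e) (he : e ∉ G.edgeSet) :
    configWeight (percQ G p) f = 0 := by
  unfold configWeight
  apply Finset.prod_eq_zero (Finset.mem_univ e)
  simp [hfe, percQ, he]

/-- **For very small retention probability, the seed set with more boundary edges is more
dangerous.** If `|S| = |S'|` and `e(S, V∖S) > e(S', V∖S')`, then there is a `p₀ > 0` such
that for all `p ∈ (0, p₀)`, `E_p[|G^p(S)|] > E_p[|G^p(S')|]`. -/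
theorem percExp_boundary_dominates_small_p {n : ℕ} (G : SimpleGraph (Fin n))
    (S S' : Finset (Fin n)) (hcard : S.card = S'.card)
    (hbd : boundaryEdgeCount G S' < boundaryEdgeCount G S) :
    ∃ p0 : ℝ, 0 < p0 ∧ ∀ p : ℝ, 0 < p → p < p0 →
      percExp G p (fun H => (clusterSize H S' : ℝ)) <
        percExp G p (fun H => (clusterSize H S : ℝ)) := by
  classical
  set E := univ.filter (fun e => e ∈ G.edgeSet) with hE
  set C : ℝ := (Fintype.card (Sym2 (Fin n) → Bool) : ℝ) * n with hC
  set m := E.card - 1 with hm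
  have hlim : ∀ᶠ p in nhds (0 : ℝ), C * p < (1 - p) ^ m := by
    apply ContinuousAt.eventually_lt
    · fun_prop
    · fun_prop
    · simp
  obtain ⟨δ, hδ, hball⟩ := Metric.eventually_nhds_iff.1 hlim
  refine ⟨min δ 1, lt_min hδ one_pos, fun p hp hp' => ?_⟩
  have hp1 : p < 1 := hp'.trans_le (min_le_right _ _)
  have hkey : C * p < (1 - p) ^ m := by
    apply hball
    rw [Real.dist_eq, sub_zero, abs_of_pos hp]
    exact hp'.trans_le (min_le_left _ _)
  set D : (Sym2 (Fin n) → Bool) → ℝ := fun f =>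
    (clusterSize (graphOfConfig f) S : ℝ) - clusterSize (graphOfConfig f) S' with hD
  have hDn : ∀ f, -(n : ℝ) ≤ D f := by
    intro f
    have h1 : (clusterSize (graphOfConfig f) S' : ℝ) ≤ n := by
      exact_mod_cast clusterSize_le_s8 _ _
    have h2 : (0 : ℝ) ≤ (clusterSize (graphOfConfig f) S : ℝ) := Nat.cast_nonneg _
    simp only [hD]
    linarith
  have hdiff : percExp G p (fun H => (clusterSize H S : ℝ)) -
      percExp G p (fun H => (clusterSize H S' : ℝ)) =
      ∑ f, configWeight (percQ G p) f * D f := by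
    unfold percExp irgExp
    rw [← Finset.sum_sub_distrib]
    refine Finset.sum_congr rfl fun f _ => ?_
    simp only [hD, mul_sub]
    rfl
  have hn0 : (0 : ℝ) ≤ n * p ^ 2 := by positivity
  have hterm : ∀ f, (if f ∈ E.image singleCfg then p * (1 - p) ^ m * D f else 0) - n * p ^ 2 ≤
      configWeight (percQ G p) f * D f := by
    intro f
    split_ifs with hf
    · obtain ⟨e, he, rfl⟩ := Finset.mem_image.1 hf
      rw [weight_single G p e (Finset.mem_filter.1 he).2]
      linarith
    · by_cases hemp : ∀ e, f e = false
      · have : D f = 0 := by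
          simp only [hD, clusterSize_empty S f hemp, clusterSize_empty S' f hemp, hcard, sub_self]
        rw [this]
        linarith
      · push Not at hemp
        obtain ⟨e, hfe⟩ := hemp
        have hfe : f e = true := by simpa using hfe
        by_cases he : e ∈ G.edgeSet
        · have : ∃ e', e' ≠ e ∧ f e' = true := by
            by_contra hcon
            push Not at hcon
            apply hf
            refine Finset.mem_image.2 ⟨e, by simp [hE, he], ?_⟩
            funext x
            by_cases hx : x = e
            · simp [singleCfg, hx, hfe]
            · have := hcon x hx
              simp [singleCfg, hx, this]
          obtain ⟨e', hne, hfe'⟩ := this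
          obtain ⟨w0, w1⟩ := weight_two G p hp.le hp1.le f e e' hne hfe hfe'
          have hn' : (0 : ℝ) ≤ n := Nat.cast_nonneg _
          nlinarith [mul_le_mul_of_nonneg_left (hDn f) w0, mul_le_mul_of_nonneg_left w1 hn']
        · rw [weight_not_mem G p f e hfe he]
          linarith
  have hsum := Finset.sum_le_sum (s := univ) fun f _ => hterm f
  rw [← hdiff, Finset.sum_sub_distrib, ← Finset.sum_filter, Finset.sum_const, nsmul_eq_mul,
    Finset.filter_mem_eq_inter, Finset.univ_inter,
    Finset.sum_image (fun a _ b _ h => singleCfg_injective h), ← Finset.mul_sum] at hsum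
  have hDs : ∑ e ∈ E, D (singleCfg e) = (boundaryEdgeCount G S : ℝ) - boundaryEdgeCount G S' := by
    simp only [hD]
    rw [Finset.sum_sub_distrib, sum_clusterSize_single, sum_clusterSize_single, hcard]
    ring
  have hge : (1 : ℝ) ≤ ∑ e ∈ E, D (singleCfg e) := by
    rw [hDs]
    have : (boundaryEdgeCount G S' : ℝ) + 1 ≤ boundaryEdgeCount G S := by exact_mod_cast hbd
    linarith
  have hpos : 0 ≤ p * (1 - p) ^ m := mul_nonneg hp.le (pow_nonneg (by linarith) _)
  have h3 := mul_le_mul_of_nonneg_left hge hpos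
  have h4 := mul_lt_mul_of_pos_left hkey hp
  have h5 : ((univ : Finset (Sym2 (Fin n) → Bool)).card : ℝ) * (n * p ^ 2) = p * (C * p) := by
    rw [hC, Finset.card_univ]
    ring
  rw [h5] at hsum
  linarith
end
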